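/- Let A ≥ 2 and ε > 0 be fixed and let j ∈ {2, 3}. Suppose x is sufficiently large, x^{ε} ≤ y ≤ x, and 2 ≤ P ≤ Q ≤ exp((log x)^{1−ε}). Then ∑_{x < n ≤ x+y} (𝔖_j(n,P) − 𝔓_j(n,Q))² ≤ C (y P^{−1} log x + y (log x)^{−A}), where C depends only on A and ε. -/

import Mathlib

open scoped Classical
open MeasureTheory

noncomputable section

/-- `e x = exp(2 π i x)`. -/
def e (x : ℝ) : ℂ := Complex.exp (2 * Real.pi * Complex.I * x)

/-- `S(q,a) = ∑_{1 ≤ x ≤ q, (x,q)=1} e(a x² / q)`. -/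
def Sqa (q : ℕ) (a : ℤ) : ℂ :=
  ∑ x ∈ (Finset.Icc 1 q).filter (fun x => Nat.gcd x q = 1),
    e ((a : ℝ) * (x : ℝ) ^ 2 / (q : ℝ))

/-- `A₂(n,q) = (μ(q)/φ(q)²) ∑_{1 ≤ a ≤ q, (a,q)=1} S(q,a) e(-a n / q)`. -/
def A2 (n q : ℕ) : ℂ :=
  (((ArithmeticFunction.moebius q : ℤ) : ℝ) / ((Nat.totient q : ℝ)) ^ 2 : ℝ) *
    ∑ a ∈ (Finset.Icc 1 q).filter (fun a => Nat.gcd a q = 1),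
      Sqa q a * e (-((a : ℝ) * (n : ℝ) / (q : ℝ)))

/-- `A₃(n,q) = φ(q)⁻³ ∑_{1 ≤ a ≤ q, (a,q)=1} S(q,a)³ e(-a n / q)`. -/
def A3 (n q : ℕ) : ℂ :=
  ((((Nat.totient q : ℝ)) ^ 3)⁻¹ : ℝ) *
    ∑ a ∈ (Finset.Icc 1 q).filter (fun a => Nat.gcd a q = 1),
      (Sqa q a) ^ 3 * e (-((a : ℝ) * (n : ℝ) / (q : ℝ)))

/-- `𝔖₂(n,P) = ∑_{1 ≤ q ≤ P} A₂(n,q)`. -/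
def SS2 (n : ℕ) (P : ℝ) : ℂ := ∑ q ∈ Finset.Icc 1 ⌊P⌋₊, A2 n q

/-- `𝔖₃(n,P) = ∑_{1 ≤ q ≤ P} A₃(n,q)`. -/
def SS3 (n : ℕ) (P : ℝ) : ℂ := ∑ q ∈ Finset.Icc 1 ⌊P⌋₊, A3 n q

/-- `𝔓₂(n,Q) = ∏_{p ≤ Q} (1 + A₂(n,p) + A₂(n,p²) + ⋯)`. -/
def PP2 (n : ℕ) (Q : ℝ) : ℂ :=
  ∏ p ∈ (Finset.Icc 1 ⌊Q⌋₊).filter Nat.Prime, (1 + ∑' k : ℕ, A2 n (p ^ (k + 1)))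

/-- `𝔓₃(n,Q) = ∏_{p ≤ Q} (1 + A₃(n,p) + A₃(n,p²) + ⋯)`. -/
def PP3 (n : ℕ) (Q : ℝ) : ℂ :=
  ∏ p ∈ (Finset.Icc 1 ⌊Q⌋₊).filter Nat.Prime, (1 + ∑' k : ℕ, A3 n (p ^ (k + 1)))

/-- `n ∈ ℋ₂`: `n` is a positive even integer with `n ≢ 1 (mod 3)`. -/
def H2mem (n : ℕ) : Prop := 0 < n ∧ 2 ∣ n ∧ n % 3 ≠ 1

/-- `n ∈ ℋ₃`: `n ≡ 3 (mod 24)` and `5 ∤ n`. -/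
def H3mem (n : ℕ) : Prop := n % 24 = 3 ∧ ¬ (5 ∣ n)

/-- `m ∈ I₁ = [X - Y, X)`. -/
def inI1 (X Y : ℝ) (m : ℕ) : Prop := X - Y ≤ (m : ℝ) ∧ (m : ℝ) < X

/-- `m ∈ I₂ = [Y^{1/2}/2, Y^{1/2})`. -/
def inI2 (Y : ℝ) (m : ℕ) : Prop := Real.sqrt Y / 2 ≤ (m : ℝ) ∧ (m : ℝ) < Real.sqrt Y

/-- `R₂(n)`: the number of pairs of primes `(p₁, p₂)` with `p₁ + p₂² = n`,
`p₁ ∈ I₁`, `p₂ ∈ I₂`. -/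
def R2cnt (X Y : ℝ) (n : ℕ) : ℕ :=
  Nat.card {p : ℕ × ℕ // p.1.Prime ∧ p.2.Prime ∧ p.1 + p.2 ^ 2 = n ∧
    inI1 X Y p.1 ∧ inI2 Y p.2}

/-- `r₂(n) = ∑_{m₁ + m₂² = n, m₁ ∈ I₁, m₂ ∈ I₂} 1 / (log m₁ · log m₂)`,
summed over pairs of positive integers. -/
def r2 (X Y : ℝ) (n : ℕ) : ℝ :=
  ∑ m ∈ Finset.Ioc 0 n ×ˢ Finset.Ioc 0 n,
    if m.1 + m.2 ^ 2 = n ∧ inI1 X Y m.1 ∧ inI2 Y m.2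
    then 1 / (Real.log m.1 * Real.log m.2) else 0

/-- The major arcs `𝔐 = ⋃_{q ≤ P} ⋃_{1 ≤ a ≤ q, (a,q)=1} [a/q - 1/(qQ), a/q + 1/(qQ)]`. -/
def majorArcs (P Q : ℝ) : Set ℝ :=
  ⋃ q ∈ Finset.Icc 1 ⌊P⌋₊, ⋃ a ∈ (Finset.Icc 1 q).filter (fun a => Nat.gcd a q = 1),
    Set.Icc ((a : ℝ) / q - 1 / (q * Q)) ((a : ℝ) / q + 1 / (q * Q))

/-- The minor arcs `𝔪 = [1/Q, 1 + 1/Q] ∖ 𝔐`. -/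
def minorArcs (P Q : ℝ) : Set ℝ := Set.Icc (1 / Q) (1 + 1 / Q) \ majorArcs P Q

/-- `D(χ) = 1` if `χ` is principal, `0` otherwise. -/
def Dind {q : ℕ} (χ : DirichletCharacter ℂ q) : ℂ := if χ = 1 then 1 else 0

lemma sum_coprime_eq_units (q : ℕ) [NeZero q] (f : ZMod q → ℂ) :
    ∑ x ∈ (Finset.Icc 1 q).filter (fun x => Nat.gcd x q = 1), f (x : ZMod q) =
      ∑ x : (ZMod q)ˣ, f (x : ZMod q) := by
  have hq : 0 < q := Nat.pos_of_ne_zero (NeZero.ne q)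
  symm
  refine Finset.sum_bij (fun (u : (ZMod q)ˣ) _ => ((u : ZMod q) - 1).val + 1) ?_ ?_ ?_ ?_
  · intro u _
    have h1 : ((((u : ZMod q) - 1).val + 1 : ℕ) : ZMod q) = u := by simp
    simp only [Finset.mem_filter, Finset.mem_Icc]
    refine ⟨⟨by omega, ZMod.val_lt _⟩, ?_⟩
    have h2 : IsUnit ((((u : ZMod q) - 1).val + 1 : ℕ) : ZMod q) := by rw [h1]; exact u.isUnit
    exact (ZMod.isUnit_iff_coprime _ _).1 h2
  · intro u _ v _ h
    have h' : ((u : ZMod q) - 1).val = ((v : ZMod q) - 1).val := by omega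
    have := ZMod.val_injective q h'
    exact Units.ext (by simpa using this)
  · intro x hx
    simp only [Finset.mem_filter, Finset.mem_Icc] at hx
    refine ⟨ZMod.unitOfCoprime x hx.2, Finset.mem_univ _, ?_⟩
    have : ((x : ZMod q) - 1) = ((x - 1 : ℕ) : ZMod q) := by
      rw [Nat.cast_sub hx.1.1]; simp
    simp only [ZMod.coe_unitOfCoprime, this]
    rw [ZMod.val_natCast, Nat.mod_eq_of_lt (by omega)]
    omega
  · intro u _
    simp

lemma e_eq_std (q : ℕ) [NeZero q] (j : ℤ) : e ((j : ℝ) / (q : ℝ)) = ZMod.stdAddChar (j : ZMod q) := by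
  rw [ZMod.stdAddChar_coe, e]
  push_cast
  congr 1
  ring

def GS (q : ℕ) [NeZero q] (a : ZMod q) : ℂ := ∑ x : (ZMod q)ˣ, ZMod.stdAddChar (a * (x : ZMod q) ^ 2)

def TT (k q : ℕ) [NeZero q] (n : ZMod q) : ℂ :=
  ∑ a : (ZMod q)ˣ, GS q a ^ k * ZMod.stdAddChar (-((a : ZMod q) * n))

def VV (k q : ℕ) [NeZero q] : ℝ := ∑ a : (ZMod q)ˣ, ‖GS q a‖ ^ (2 * k)

lemma Sqa_eq (q : ℕ) [NeZero q] (a : ℤ) : Sqa q a = GS q (a : ZMod q) := by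
  unfold Sqa GS
  rw [← sum_coprime_eq_units q (fun x => ZMod.stdAddChar ((a : ZMod q) * x ^ 2))]
  refine Finset.sum_congr rfl fun x _ => ?_
  have := e_eq_std q (a * (x : ℤ) ^ 2)
  push_cast at this
  exact this

lemma TT_eq (k q n : ℕ) [NeZero q] :
    ∑ a ∈ (Finset.Icc 1 q).filter (fun a => Nat.gcd a q = 1),
      (Sqa q a) ^ k * e (-((a : ℝ) * (n : ℝ) / (q : ℝ))) = TT k q (n : ZMod q) := by
  unfold TT
  rw [← sum_coprime_eq_units q (fun a => GS q a ^ k * ZMod.stdAddChar (-(a * (n : ZMod q))))]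
  refine Finset.sum_congr rfl fun a _ => ?_
  rw [Sqa_eq]
  have := e_eq_std q (-(a * (n : ℤ)))
  push_cast at this
  rw [← this, neg_div]
  simp

lemma VV_eq (k q : ℕ) [NeZero q] :
    ∑ a ∈ (Finset.Icc 1 q).filter (fun a => Nat.gcd a q = 1), ‖Sqa q a‖ ^ (2 * k) = VV k q := by
  have := sum_coprime_eq_units q (fun a => ((‖GS q a‖ ^ (2 * k) : ℝ) : ℂ))
  unfold VV
  have h2 : ∀ a : ℕ, Sqa q a = GS q (a : ZMod q) := fun a => by rw [Sqa_eq]; simp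
  simp only [h2]
  exact_mod_cast this

lemma std_mul (m n : ℕ) [NeZero m] [NeZero n] (h : m.Coprime n) :
    ∃ (u : (ZMod m)ˣ) (v : (ZMod n)ˣ), ∀ x : ZMod (m * n),
      ZMod.stdAddChar x = (ZMod.stdAddChar ((u : ZMod m) * (ZMod.chineseRemainder h x).1) : ℂ) *
        ZMod.stdAddChar ((v : ZMod n) * (ZMod.chineseRemainder h x).2) := by
  have hb := Nat.gcd_eq_gcd_ab m n
  rw [h.gcd_eq_one] at hb
  set s := Nat.gcdA m n
  set t := Nat.gcdB m n
  have hu : (t : ZMod m) * (n : ZMod m) = 1 := by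
    have := congrArg (Int.cast : ℤ → ZMod m) hb
    push_cast at this
    rw [this]; simp [mul_comm]
  have hv : (s : ZMod n) * (m : ZMod n) = 1 := by
    have := congrArg (Int.cast : ℤ → ZMod n) hb
    push_cast at this
    rw [this]; simp [mul_comm]
  refine ⟨Units.mkOfMulEqOne _ _ hu, Units.mkOfMulEqOne _ _ hv, fun x => ?_⟩
  obtain ⟨j, rfl⟩ := ZMod.intCast_surjective x
  simp only [Units.val_mkOfMulEqOne, map_intCast, Prod.fst_intCast, Prod.snd_intCast]
  rw [← Int.cast_mul, ← Int.cast_mul, ZMod.stdAddChar_coe, ZMod.stdAddChar_coe, ZMod.stdAddChar_coe,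
    ← Complex.exp_add]
  congr 1
  have hm : (m : ℂ) ≠ 0 := by exact_mod_cast NeZero.ne m
  have hn : (n : ℂ) ≠ 0 := by exact_mod_cast NeZero.ne n
  have hb' : (1 : ℂ) = m * s + n * t := by exact_mod_cast hb
  push_cast
  field_simp
  linear_combination (j : ℂ) * hb'

def unitsE (m n : ℕ) (h : m.Coprime n) : (ZMod (m * n))ˣ ≃* (ZMod m)ˣ × (ZMod n)ˣ :=
  (Units.mapEquiv (ZMod.chineseRemainder h).toMulEquiv).trans MulEquiv.prodUnits

lemma unitsE_fst (m n : ℕ) (h : m.Coprime n) (x : (ZMod (m * n))ˣ) :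
    (((unitsE m n h x).1 : (ZMod m)ˣ) : ZMod m) = (ZMod.chineseRemainder h (x : ZMod (m * n))).1 := rfl

lemma unitsE_snd (m n : ℕ) (h : m.Coprime n) (x : (ZMod (m * n))ˣ) :
    (((unitsE m n h x).2 : (ZMod n)ˣ) : ZMod n) = (ZMod.chineseRemainder h (x : ZMod (m * n))).2 := rfl

lemma GS_mul (m n : ℕ) [NeZero m] [NeZero n] (h : m.Coprime n) (u : (ZMod m)ˣ) (v : (ZMod n)ˣ)
    (huv : ∀ x : ZMod (m * n),
      ZMod.stdAddChar x = (ZMod.stdAddChar ((u : ZMod m) * (ZMod.chineseRemainder h x).1) : ℂ) *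
        ZMod.stdAddChar ((v : ZMod n) * (ZMod.chineseRemainder h x).2)) (a : ZMod (m * n)) :
    GS (m * n) a = GS m (u * (ZMod.chineseRemainder h a).1) * GS n (v * (ZMod.chineseRemainder h a).2) := by
  unfold GS
  rw [Finset.sum_mul_sum, ← Finset.sum_product', Finset.univ_product_univ,
    ← Equiv.sum_comp (unitsE m n h).toEquiv]
  refine Finset.sum_congr rfl fun x _ => ?_
  rw [huv]
  simp only [map_mul, map_pow, Prod.fst_mul, Prod.snd_mul, Prod.pow_fst, Prod.pow_snd, MulEquiv.toEquiv_eq_coe,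
    MulEquiv.coe_toEquiv, unitsE_fst, unitsE_snd, mul_assoc]

lemma sum_units_mul (m n : ℕ) [NeZero m] [NeZero n] (h : m.Coprime n) (u : (ZMod m)ˣ) (v : (ZMod n)ˣ)
    {M : Type*} [CommSemiring M] (f : ZMod m → M) (g : ZMod n → M) :
    ∑ a : (ZMod (m * n))ˣ, f (u * (ZMod.chineseRemainder h (a : ZMod (m * n))).1) *
        g (v * (ZMod.chineseRemainder h (a : ZMod (m * n))).2) =
      (∑ a : (ZMod m)ˣ, f a) * ∑ a : (ZMod n)ˣ, g a := by
  rw [← Equiv.sum_comp (Equiv.mulLeft u) (fun a : (ZMod m)ˣ => f a),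
    ← Equiv.sum_comp (Equiv.mulLeft v) (fun a : (ZMod n)ˣ => g a),
    Finset.sum_mul_sum, ← Finset.sum_product', Finset.univ_product_univ,
    ← Equiv.sum_comp (unitsE m n h).toEquiv]
  refine Finset.sum_congr rfl fun x _ => ?_
  simp [unitsE_fst, unitsE_snd]

lemma TT_mul (k m n : ℕ) [NeZero m] [NeZero n] (h : m.Coprime n) (N : ℕ) :
    TT k (m * n) (N : ZMod (m * n)) = TT k m (N : ZMod m) * TT k n (N : ZMod n) := by
  obtain ⟨u, v, huv⟩ := std_mul m n h
  unfold TT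
  rw [← sum_units_mul m n h u v (fun a => GS m a ^ k * ZMod.stdAddChar (-(a * (N : ZMod m))))
    (fun a => GS n a ^ k * ZMod.stdAddChar (-(a * (N : ZMod n))))]
  refine Finset.sum_congr rfl fun a _ => ?_
  rw [GS_mul m n h u v huv, huv (-((a : ZMod (m * n)) * N))]
  simp only [map_neg, map_mul, map_natCast, Prod.fst_neg, Prod.snd_neg, Prod.fst_mul, Prod.snd_mul,
    Prod.fst_natCast, Prod.snd_natCast, mul_neg, mul_assoc, mul_pow]
  ring

lemma VV_mul (k m n : ℕ) [NeZero m] [NeZero n] (h : m.Coprime n) :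
    VV k (m * n) = VV k m * VV k n := by
  obtain ⟨u, v, huv⟩ := std_mul m n h
  unfold VV
  rw [← sum_units_mul m n h u v (fun a => ‖GS m a‖ ^ (2 * k)) (fun a => ‖GS n a‖ ^ (2 * k))]
  refine Finset.sum_congr rfl fun a _ => ?_
  rw [GS_mul m n h u v huv, norm_mul, mul_pow]

lemma std_norm (q : ℕ) [NeZero q] (x : ZMod q) : ‖(ZMod.stdAddChar x : ℂ)‖ = 1 := by
  simp

lemma GS_norm_le (q : ℕ) [NeZero q] (a : ZMod q) : ‖GS q a‖ ≤ q.totient := by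
  unfold GS
  refine (norm_sum_le _ _).trans ?_
  simp [ZMod.card_units_eq_totient]

/-- vanishing -/
lemma GS_zero (q : ℕ) [NeZero q] (t : ZMod q) (ht : t * t = 0) (ht2 : 2 * t ≠ 0) (a : (ZMod q)ˣ) :
    GS q a = 0 := by
  have key : ∀ j : ZMod q, GS q a = ∑ x : (ZMod q)ˣ, (ZMod.stdAddChar ((a : ZMod q) * (x : ZMod q) ^ 2) : ℂ) *
      ZMod.stdAddChar (j * ((a : ZMod q) * (x : ZMod q) ^ 2 * (2 * t))) := by
    intro j
    have hu : (1 + j * t) * (1 - j * t) = 1 := by linear_combination -j ^ 2 * ht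
    unfold GS
    rw [← Equiv.sum_comp (Equiv.mulLeft (Units.mkOfMulEqOne _ _ hu))]
    refine Finset.sum_congr rfl fun x _ => ?_
    rw [← AddChar.map_add_eq_mul]
    congr 1
    simp only [Equiv.coe_mulLeft, Units.val_mul, Units.val_mkOfMulEqOne]
    linear_combination (a : ZMod q) * (x : ZMod q) ^ 2 * j ^ 2 * ht
  have h2 : (q : ℂ) * GS q a = 0 := by
    have : (q : ℂ) * GS q a = ∑ j : ZMod q, GS q a := by simp [ZMod.card]
    rw [this, Finset.sum_congr rfl fun j _ => key j, Finset.sum_comm]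
    refine Finset.sum_eq_zero fun x _ => ?_
    rw [← Finset.mul_sum, AddChar.sum_mulShift _ (ZMod.isPrimitive_stdAddChar q), if_neg, Nat.cast_zero, mul_zero]
    intro h0
    apply ht2
    have h1 : ((a * x ^ 2 : (ZMod q)ˣ) : ZMod q) * (2 * t) = 0 := by push_cast; exact h0
    exact (Units.mul_right_eq_zero _).1 h1
  have hq : (q : ℂ) ≠ 0 := by exact_mod_cast NeZero.ne q
  exact (mul_eq_zero.1 h2).resolve_left hq

lemma GS_prime_pow_zero (p k : ℕ) [hp : Fact p.Prime] (hk : (p ≠ 2 ∧ 2 ≤ k) ∨ (p = 2 ∧ 4 ≤ k))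
    (a : (ZMod (p ^ k))ˣ) : GS (p ^ k) a = 0 := by
  rcases hk with ⟨h2, hk⟩ | ⟨rfl, hk⟩
  · refine GS_zero _ ((p ^ (k - 1) : ℕ) : ZMod (p ^ k)) ?_ ?_ a
    · rw [← Nat.cast_mul, ZMod.natCast_eq_zero_iff, ← pow_add]
      exact pow_dvd_pow _ (by omega)
    · intro h
      have h' : ((2 * p ^ (k - 1) : ℕ) : ZMod (p ^ k)) = 0 := by simpa using h
      rw [ZMod.natCast_eq_zero_iff] at h'
      have h3 : p ^ k = p * p ^ (k - 1) := by rw [← pow_succ']; congr 1; omega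
      rw [h3] at h'
      have h4 := Nat.dvd_of_mul_dvd_mul_right (pow_pos hp.out.pos _) h'
      exact h2 ((Nat.prime_dvd_prime_iff_eq hp.out Nat.prime_two).1 h4)
  · refine GS_zero _ ((2 ^ (k - 2) : ℕ) : ZMod (2 ^ k)) ?_ ?_ a
    · rw [← Nat.cast_mul, ZMod.natCast_eq_zero_iff, ← pow_add]
      exact pow_dvd_pow _ (by omega)
    · intro h
      have h' : ((2 ^ (k - 1) : ℕ) : ZMod (2 ^ k)) = 0 := by
        have : 2 ^ (k - 1) = 2 * 2 ^ (k - 2) := by rw [← pow_succ']; congr 1; omega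
        rw [this]
        simpa using h
      rw [ZMod.natCast_eq_zero_iff] at h'
      have := (Nat.pow_dvd_pow_iff_le_right (by norm_num : 1 < 2)).1 h'
      omega

lemma sum_field_units (p : ℕ) [hp : Fact p.Prime] (f : ZMod p → ℂ) :
    ∑ x : ZMod p, f x = f 0 + ∑ x : (ZMod p)ˣ, f x := by
  rw [← Finset.add_sum_erase _ _ (Finset.mem_univ (0 : ZMod p))]
  congr 1
  symm
  refine Finset.sum_bij (fun (u : (ZMod p)ˣ) _ => (u : ZMod p)) ?_ ?_ ?_ ?_
  · intro u _; simp
  · intro u _ v _ h; exact Units.ext h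
  · intro x hx
    simp only [Finset.mem_erase] at hx
    exact ⟨Units.mk0 x hx.1, Finset.mem_univ _, rfl⟩
  · intro u _; rfl

lemma GS_prime (p : ℕ) [hp : Fact p.Prime] (h2 : p ≠ 2) :
    ∃ (g : ℂ) (c : (ZMod p)ˣ → ℂ), ‖g‖ ^ 2 = p ∧ (∀ a, c a ^ 2 = 1) ∧
      (∀ a : (ZMod p)ˣ, GS p a = c a * g - 1) ∧
      ∀ n : ZMod p, ‖∑ a, c a * ZMod.stdAddChar (-((a : ZMod p) * n))‖ ≤ ‖g‖ := by
  have hc : ringChar (ZMod p) ≠ 2 := by rwa [ZMod.ringChar_zmod_n]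
  set χ : MulChar (ZMod p) ℂ := (quadraticChar (ZMod p)).ringHomComp (Int.castRingHom ℂ) with hχ
  have hχv : ∀ a, χ a = ((quadraticChar (ZMod p) a : ℤ) : ℂ) := fun a => rfl
  have hχ1 : χ ≠ 1 := by
    rw [hχ]
    exact (MulChar.ringHomComp_ne_one_iff (Int.cast_injective)).2 (quadraticChar_ne_one hc)
  have hχ2 : χ.IsQuadratic := (quadraticChar_isQuadratic (ZMod p)).comp _
  have hsq : ∀ a : (ZMod p)ˣ, χ a ^ 2 = 1 := fun a => by
    rw [hχv]
    exact_mod_cast quadraticChar_sq_one a.ne_zero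
  have hn1 : ∀ a : (ZMod p)ˣ, ‖χ a‖ = 1 := fun a => by
    have := congrArg norm (hsq a)
    rw [norm_pow, norm_one] at this
    exact (pow_eq_one_iff_of_nonneg (norm_nonneg _) two_ne_zero).1 this
  set ψ : AddChar (ZMod p) ℂ := ZMod.stdAddChar with hψ
  have hprim : ψ.IsPrimitive := ZMod.isPrimitive_stdAddChar p
  refine ⟨gaussSum χ ψ, fun a => χ a, ?_, hsq, ?_, ?_⟩
  · have := congrArg norm (gaussSum_sq hχ1 hχ2 hprim)
    rw [norm_pow, norm_mul] at this
    have h3 := hn1 (-1)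
    simp only [Units.val_neg, Units.val_one] at h3
    rw [h3, ZMod.card] at this
    simpa using this
  · intro a
    have h1 : GS p a = ∑ x : ZMod p, ψ (a * x ^ 2) - 1 := by
      rw [sum_field_units p (fun x => ψ (a * x ^ 2))]
      simp [GS, hψ]
    rw [h1]
    congr 1
    have h3 : ∑ x : ZMod p, ψ (a * x ^ 2) = ∑ t : ZMod p, (χ t + 1) * ψ (a * t) := by
      rw [← Finset.sum_fiberwise (s := Finset.univ) (g := fun x : ZMod p => x ^ 2)]
      refine Finset.sum_congr rfl fun t _ => ?_
      have h4 := quadraticChar_card_sqrts hc t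
      have h5 : (χ t + 1) = ((Finset.univ.filter fun x : ZMod p => x ^ 2 = t).card : ℂ) := by
        rw [hχv]
        have h6 : {x : ZMod p | x ^ 2 = t}.toFinset = Finset.univ.filter fun x : ZMod p => x ^ 2 = t := by
          ext; simp
        rw [h6] at h4
        exact_mod_cast h4.symm
      rw [h5, ← nsmul_eq_mul, ← Finset.sum_const]
      refine Finset.sum_congr rfl fun x hx => ?_
      rw [(Finset.mem_filter.1 hx).2]
    rw [h3]
    simp only [add_mul, one_mul, Finset.sum_add_distrib]
    have h6 : ∑ t : ZMod p, ψ (a * t) = 0 := by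
      have := AddChar.sum_mulShift (a : ZMod p) hprim
      rw [if_neg a.ne_zero] at this
      simpa [mul_comm] using this
    rw [h6, add_zero, ← gaussSum_mulShift χ ψ a, ← mul_assoc, ← sq, hsq, one_mul]
    rfl
  · intro n
    have h1 : ∑ a : (ZMod p)ˣ, χ a * ψ (-((a : ZMod p) * n)) = gaussSum χ (ψ.mulShift (-n)) := by
      unfold gaussSum
      rw [sum_field_units p (fun a => χ a * ψ.mulShift (-n) a)]
      simp [AddChar.mulShift_apply, mul_comm n, MulChar.map_zero χ]
    rw [h1]
    by_cases hn : n = 0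
    · subst hn
      rw [neg_zero, AddChar.mulShift_zero, gaussSum_one_right hχ1]
      simp
    · have := gaussSum_mulShift χ ψ (Units.mk0 (-n) (neg_ne_zero.2 hn))
      have h7 := congrArg norm this
      rw [norm_mul, hn1, one_mul] at h7
      exact h7.le

lemma GS_prime_norm (p : ℕ) [hp : Fact p.Prime] (h2 : p ≠ 2) (a : (ZMod p)ˣ) :
    ‖GS p a‖ ≤ √p + 1 := by
  obtain ⟨g, c, hg, hc, hG, -⟩ := GS_prime p h2
  have h1 : ‖c a‖ = 1 := by
    have := congrArg norm (hc a)
    rw [norm_pow, norm_one] at this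
    exact (pow_eq_one_iff_of_nonneg (norm_nonneg _) two_ne_zero).1 this
  have hg' : ‖g‖ = √p := by rw [← hg, Real.sqrt_sq (norm_nonneg _)]
  rw [hG]
  refine (norm_sub_le _ _).trans ?_
  simp [h1, hg']

lemma unit_sum_norm (p : ℕ) [hp : Fact p.Prime] (n : ZMod p) :
    ‖∑ a : (ZMod p)ˣ, (ZMod.stdAddChar (-((a : ZMod p) * n)) : ℂ)‖ ≤ p := by
  refine (norm_sum_le _ _).trans ?_
  simp [ZMod.card_units_eq_totient]
  exact Nat.totient_le p

lemma TT1_norm (p : ℕ) [hp : Fact p.Prime] (h2 : p ≠ 2) (n : ZMod p) :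
    ‖TT 1 p n‖ ≤ 8 * p := by
  obtain ⟨g, c, hg, hc, hG, hX⟩ := GS_prime p h2
  have : TT 1 p n = g * (∑ a, c a * ZMod.stdAddChar (-((a : ZMod p) * n))) -
      ∑ a : (ZMod p)ˣ, (ZMod.stdAddChar (-((a : ZMod p) * n)) : ℂ) := by
    unfold TT
    rw [Finset.mul_sum, ← Finset.sum_sub_distrib]
    refine Finset.sum_congr rfl fun a _ => ?_
    rw [hG]; ring
  rw [this]
  refine (norm_sub_le _ _).trans ?_
  have h3 := unit_sum_norm p n
  rw [norm_mul]
  nlinarith [mul_le_mul_of_nonneg_left (hX n) (norm_nonneg g), (Nat.cast_nonneg p : (0:ℝ) ≤ p)]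

lemma TT3_norm (p : ℕ) [hp : Fact p.Prime] (h2 : p ≠ 2) (n : ZMod p) :
    ‖TT 3 p n‖ ≤ 8 * p ^ 2 := by
  obtain ⟨g, c, hg, hc, hG, hX⟩ := GS_prime p h2
  have : TT 3 p n = (g ^ 3 + 3 * g) * (∑ a, c a * ZMod.stdAddChar (-((a : ZMod p) * n))) -
      (3 * g ^ 2 + 1) * ∑ a : (ZMod p)ˣ, (ZMod.stdAddChar (-((a : ZMod p) * n)) : ℂ) := by
    unfold TT
    rw [Finset.mul_sum, Finset.mul_sum, ← Finset.sum_sub_distrib]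
    refine Finset.sum_congr rfl fun a _ => ?_
    rw [hG]
    linear_combination ((ZMod.stdAddChar (-((a : ZMod p) * n)) : ℂ)) * (c a * g ^ 3 - 3 * g ^ 2) * hc a
  rw [this]
  refine (norm_sub_le _ _).trans ?_
  have h3 := unit_sum_norm p n
  have h4 := hX n
  rw [norm_mul, norm_mul]
  have h5 : ‖g ^ 3 + 3 * g‖ ≤ ‖g‖ ^ 3 + 3 * ‖g‖ := by
    refine (norm_add_le _ _).trans ?_
    simp
  have h6 : ‖3 * g ^ 2 + 1‖ ≤ 3 * ‖g‖ ^ 2 + 1 := by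
    refine (norm_add_le _ _).trans ?_
    simp
  have hp1 : (1 : ℝ) ≤ p := by exact_mod_cast hp.out.one_lt.le
  calc _ ≤ (‖g‖ ^ 3 + 3 * ‖g‖) * ‖g‖ + (3 * ‖g‖ ^ 2 + 1) * p := by
        gcongr
    _ = (‖g‖ ^ 2) ^ 2 + 3 * ‖g‖ ^ 2 + (3 * ‖g‖ ^ 2 + 1) * p := by ring
    _ ≤ _ := by rw [hg]; nlinarith

structure Hyp (A : ℕ → ℕ → ℂ) (b : ℕ → ℕ → ℂ) (K : ℝ) : Prop where
  hA : ∀ n q, 0 < q → A n q = ∑ a ∈ (Finset.Icc 1 q).filter (fun a => Nat.gcd a q = 1),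
      b q a * e (-((a : ℝ) * (n : ℝ) / (q : ℝ)))
  one : ∀ n, A n 1 = 1
  mul : ∀ n {m m' : ℕ}, m.Coprime m' → A n (m * m') = A n m * A n m'
  pp : ∀ n p k, p.Prime → 1 ≤ k → ‖A n (p ^ k)‖ ≤ K / p
  pz : ∀ n p k, p.Prime → 4 ≤ k → A n (p ^ k) = 0
  hM : ∀ q : ℕ, 0 < q → (q : ℝ) ^ 2 * ∑ a ∈ (Finset.Icc 1 q).filter (fun a => Nat.gcd a q = 1),
      ‖b q a‖ ^ 2 ≤ ∏ p ∈ q.primeFactors, (1 + K / √p)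
  hK : 1 ≤ K

def AA (k : ℕ) (w : ℕ → ℝ) (n q : ℕ) : ℂ :=
  (w q : ℂ) * ∑ a ∈ (Finset.Icc 1 q).filter (fun a => Nat.gcd a q = 1),
      (Sqa q a) ^ k * e (-((a : ℝ) * (n : ℝ) / (q : ℝ)))

lemma AA_eq (k : ℕ) (w : ℕ → ℝ) (n q : ℕ) [NeZero q] : AA k w n q = (w q : ℂ) * TT k q (n : ZMod q) := by
  unfold AA; rw [TT_eq]

lemma TT_norm_le (k q : ℕ) [NeZero q] (n : ZMod q) : ‖TT k q n‖ ≤ (q.totient : ℝ) ^ k * q.totient := by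
  unfold TT
  refine (norm_sum_le _ _).trans ?_
  have : ∀ a ∈ (Finset.univ : Finset (ZMod q)ˣ), ‖GS q a ^ k * (ZMod.stdAddChar (-((a : ZMod q) * n)) : ℂ)‖ ≤
      (q.totient : ℝ) ^ k := by
    intro a _
    rw [norm_mul, norm_pow, std_norm, mul_one]
    exact pow_le_pow_left₀ (norm_nonneg _) (GS_norm_le q a) k
  refine (Finset.sum_le_card_nsmul _ _ _ this).trans ?_
  simp [ZMod.card_units_eq_totient, mul_comm]

lemma VV_le (k q : ℕ) [NeZero q] : VV k q ≤ (q.totient : ℝ) ^ (2 * k) * q.totient := by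
  unfold VV
  have : ∀ a ∈ (Finset.univ : Finset (ZMod q)ˣ), ‖GS q a‖ ^ (2 * k) ≤ (q.totient : ℝ) ^ (2 * k) := by
    intro a _
    exact pow_le_pow_left₀ (norm_nonneg _) (GS_norm_le q a) _
  refine (Finset.sum_le_card_nsmul _ _ _ this).trans ?_
  simp [ZMod.card_units_eq_totient, mul_comm]

lemma VV_nonneg (k q : ℕ) [NeZero q] : 0 ≤ VV k q := by
  unfold VV; positivity

lemma poly_bound {s : ℝ} (hs : (5:ℝ) / 3 ≤ s) : s ^ 4 * (s ^ 2 - 1) * ((s - 1)⁻¹ ^ 3) ^ 2 ≤ 1 + 1100 / s := by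
  have h0 : 0 < s := by linarith
  have h1 : 0 < s - 1 := by linarith
  obtain ⟨t, ht⟩ : ∃ t, t = 1 / s := ⟨_, rfl⟩
  have ht0 : 0 < t := by rw [ht]; positivity
  have ht1 : t ≤ 3 / 5 := by rw [ht, div_le_iff₀ h0]; linarith
  have hst : s = 1 / t := by rw [ht]; simp
  have h1t : 0 < 1 - t := by linarith
  have e1 : s ^ 4 * (s ^ 2 - 1) * ((s - 1)⁻¹ ^ 3) ^ 2 = ((1 - t)⁻¹) ^ 5 * (1 + t) := by
    have : s - 1 = (1 - t) / t := by rw [hst]; field_simp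
    rw [this, hst]
    field_simp
    ring
  have e2 : 1100 / s = 1100 * t := by rw [ht]; ring
  rw [e1, e2]
  have h2 : (1 - t)⁻¹ ≤ 1 + 5 / 2 * t := by
    rw [inv_le_iff_one_le_mul₀ h1t]
    nlinarith
  have h3 : ((1 - t)⁻¹) ^ 5 ≤ (1 + 5 / 2 * t) ^ 5 := pow_le_pow_left₀ (inv_pos.2 h1t).le h2 5
  have h4 : (1 + 5 / 2 * t) ^ 5 * (1 + t) ≤ 1 + 1100 * t := by
    have p2 : t ^ 2 ≤ t := by nlinarith
    have p3 : t ^ 3 ≤ t := by nlinarith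
    have p4 : t ^ 4 ≤ t := by nlinarith
    have p5 : t ^ 5 ≤ t := by nlinarith
    have p6 : t ^ 6 ≤ t := by nlinarith
    ring_nf
    linarith
  exact (mul_le_mul_of_nonneg_right h3 (by linarith)).trans h4

lemma Hyp_AA (k : ℕ) (w : ℕ → ℝ) (hk : 1 ≤ k) (w1 : w 1 = 1)
    (wmul : ∀ {m n : ℕ}, m.Coprime n → w (m * n) = w m * w n)
    (wle : ∀ q, 0 < q → |w q| * (q.totient : ℝ) ^ k ≤ 1)
    (hpt : ∀ p, [Fact p.Prime] → p ≠ 2 → ∀ n : ZMod p, |w p| * ‖TT k p n‖ ≤ 64 / p)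
    (hMp : ∀ p : ℕ, p.Prime → p ≠ 2 → |w p| * (√p + 1) ^ k ≤ (√p - 1)⁻¹ ^ 3) :
    Hyp (AA k w) (fun q a => (w q : ℂ) * Sqa q a ^ k) 1100 := by
  have hone : ∀ n, AA k w n 1 = 1 := by
    intro n
    rw [AA_eq, w1]
    have h1 : ∀ a : ZMod 1, a = 0 := fun a => Subsingleton.elim _ _
    have hG : ∀ a : ZMod 1, GS 1 a = 1 := by
      intro a
      unfold GS
      rw [Finset.sum_congr rfl (fun x _ => by rw [h1 (a * (x : ZMod 1) ^ 2), AddChar.map_zero_eq_one])]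
      simp
    unfold TT
    rw [Finset.sum_congr rfl (fun x _ => by rw [h1 (-((x : ZMod 1) * n)), AddChar.map_zero_eq_one, hG])]
    simp
  have tot2 : ∀ j, 1 ≤ j → j ≤ 3 → (((2 ^ j).totient : ℕ) : ℝ) ≤ 4 := by
    intro j h1 h3
    rw [Nat.totient_prime_pow Nat.prime_two h1]
    interval_cases j <;> norm_num
  have hsum : ∀ q, [NeZero q] → ∑ a ∈ (Finset.Icc 1 q).filter (fun a => Nat.gcd a q = 1),
      ‖(w q : ℂ) * Sqa q a ^ k‖ ^ 2 = w q ^ 2 * VV k q := by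
    intro q _
    rw [← VV_eq, Finset.mul_sum]
    refine Finset.sum_congr rfl fun a _ => ?_
    rw [norm_mul, norm_pow, mul_pow, ← pow_mul, mul_comm k 2, Complex.norm_real, Real.norm_eq_abs, sq_abs]
  refine ⟨?_, hone, ?_, ?_, ?_, ?_, by norm_num⟩
  · intro n q hq
    unfold AA
    rw [Finset.mul_sum]
    exact Finset.sum_congr rfl fun a _ => by push_cast; ring
  · intro n m m' h
    rcases Nat.eq_zero_or_pos m with rfl | hm
    · have : m' = 1 := by simpa using h
      subst this
      simp [hone]
    rcases Nat.eq_zero_or_pos m' with rfl | hm'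
    · have : m = 1 := by simpa using h
      subst this
      simp [hone]
    have : NeZero m := ⟨hm.ne'⟩
    have : NeZero m' := ⟨hm'.ne'⟩
    rw [AA_eq, AA_eq, AA_eq, TT_mul k m m' h, wmul h]
    push_cast; ring
  · intro n p j hp hj
    have : Fact p.Prime := ⟨hp⟩
    have hp0 : (0 : ℝ) < p := by exact_mod_cast hp.pos
    by_cases hz : (p ≠ 2 ∧ 2 ≤ j) ∨ (p = 2 ∧ 4 ≤ j)
    · have : AA k w n (p ^ j) = 0 := by
        rw [AA_eq]
        unfold TT
        rw [Finset.sum_congr rfl fun a _ => by rw [GS_prime_pow_zero p j hz a]]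
        simp [show k ≠ 0 by omega]
      rw [this]; simp; positivity
    · by_cases h2 : p = 2
      · subst h2
        have hj3 : j ≤ 3 := by by_contra h; exact hz (Or.inr ⟨rfl, by omega⟩)
        rw [AA_eq, norm_mul, Complex.norm_real, Real.norm_eq_abs]
        have h1 := TT_norm_le k (2 ^ j) (n : ZMod (2 ^ j))
        have h3 := wle (2 ^ j) (by positivity)
        have h4 := tot2 j hj hj3
        calc _ ≤ |w (2 ^ j)| * (((2 ^ j).totient : ℝ) ^ k * (2 ^ j).totient) := by gcongr
          _ = |w (2 ^ j)| * ((2 ^ j).totient : ℝ) ^ k * (2 ^ j).totient := by ring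
          _ ≤ 1 * 4 := by gcongr
          _ ≤ _ := by norm_num
      · have hj1 : j = 1 := by
          by_contra h; exact hz (Or.inl ⟨h2, by omega⟩)
        subst hj1
        rw [pow_one, AA_eq, norm_mul, Complex.norm_real, Real.norm_eq_abs]
        refine (hpt p h2 _).trans ?_
        gcongr
        norm_num
  · intro n p j hp hj
    have : Fact p.Prime := ⟨hp⟩
    have hz : (p ≠ 2 ∧ 2 ≤ j) ∨ (p = 2 ∧ 4 ≤ j) := by
      by_cases h : p = 2
      · exact Or.inr ⟨h, hj⟩
      · exact Or.inl ⟨h, by omega⟩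
    rw [AA_eq]
    unfold TT
    rw [Finset.sum_congr rfl fun a _ => by rw [GS_prime_pow_zero p j hz a]]
    simp [show k ≠ 0 by omega]
  · intro q hq
    set F : ℕ → ℝ := fun q => (q : ℝ) ^ 2 * ∑ a ∈ (Finset.Icc 1 q).filter (fun a => Nat.gcd a q = 1),
      ‖(w q : ℂ) * Sqa q a ^ k‖ ^ 2 with hF
    have hF' : ∀ q, [NeZero q] → F q = (q : ℝ) ^ 2 * (w q ^ 2 * VV k q) := by
      intro q _
      simp only [hF]
      rw [hsum]
    have hF1 : F 1 = 1 := by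
      rw [hF', w1]
      have h1 : ∀ a : ZMod 1, a = 0 := fun a => Subsingleton.elim _ _
      have hG : ∀ a : ZMod 1, GS 1 a = 1 := by
        intro a
        unfold GS
        rw [Finset.sum_congr rfl (fun x _ => by rw [h1 (a * (x : ZMod 1) ^ 2), AddChar.map_zero_eq_one])]
        simp
      simp [VV, hG]
    have hFm : ∀ x y : ℕ, x.Coprime y → F (x * y) = F x * F y := by
      intro m m' h
      rcases Nat.eq_zero_or_pos m with rfl | hm
      · have : m' = 1 := by simpa using h
        subst this
        rw [hF1]; simp
      rcases Nat.eq_zero_or_pos m' with rfl | hm'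
      · have : m = 1 := by simpa using h
        subst this
        rw [hF1]; simp
      have : NeZero m := ⟨hm.ne'⟩
      have : NeZero m' := ⟨hm'.ne'⟩
      rw [hF', hF', hF', VV_mul k m m' h, wmul h]
      push_cast; ring
    change F q ≤ _
    rw [Nat.multiplicative_factorization F hFm hF1 hq.ne']
    unfold Finsupp.prod
    rw [Nat.support_factorization]
    refine Finset.prod_le_prod (fun p _ => ?_) (fun p hp => ?_)
    · simp only [hF]; positivity
    have hpp := Nat.prime_of_mem_primeFactors hp
    have : Fact p.Prime := ⟨hpp⟩
    have hj : 1 ≤ q.factorization p := by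
      have := Nat.support_factorization q ▸ hp
      exact Nat.one_le_iff_ne_zero.2 (Finsupp.mem_support_iff.1 this)
    set j := q.factorization p
    change F (p ^ j) ≤ _
    by_cases hz : (p ≠ 2 ∧ 2 ≤ j) ∨ (p = 2 ∧ 4 ≤ j)
    · have : VV k (p ^ j) = 0 := by
        unfold VV
        rw [Finset.sum_congr rfl fun a _ => by rw [GS_prime_pow_zero p j hz a]]
        simp [show k ≠ 0 by omega]
      rw [hF', this]; simp; positivity
    · by_cases h2 : p = 2
      · have hj3 : j ≤ 3 := by by_contra h; exact hz (Or.inr ⟨h2, by omega⟩)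
        rw [h2, hF']
        have h1 := VV_le k (2 ^ j)
        have h3 := wle (2 ^ j) (by positivity)
        have h4 := tot2 j hj hj3
        have h5 : w (2 ^ j) ^ 2 * VV k (2 ^ j) ≤ 4 := by
          calc _ ≤ w (2 ^ j) ^ 2 * (((2 ^ j).totient : ℝ) ^ (2 * k) * (2 ^ j).totient) := by gcongr
            _ = (|w (2 ^ j)| * ((2 ^ j).totient : ℝ) ^ k) ^ 2 * (2 ^ j).totient := by
              rw [mul_pow, sq_abs]; ring
            _ ≤ 1 ^ 2 * 4 := by gcongr
            _ = 4 := by norm_num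
        have h6 : (((2 ^ j : ℕ) : ℝ)) ^ 2 ≤ 64 := by
          have : ((2 ^ j : ℕ) : ℝ) ≤ 8 := by
            have : 2 ^ j ≤ 2 ^ 3 := Nat.pow_le_pow_right (by norm_num) hj3
            exact_mod_cast this
          nlinarith [(Nat.cast_nonneg (2 ^ j) : (0:ℝ) ≤ _)]
        have h7 : √((2:ℕ):ℝ) ≤ 2 := by
          rw [Real.sqrt_le_left (by norm_num)]; norm_num
        have h8 : (1100 : ℝ) / 2 ≤ 1100 / √((2:ℕ):ℝ) := by
          apply div_le_div_of_nonneg_left (by norm_num) (by positivity) h7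
        calc _ ≤ (64 : ℝ) * 4 := by
              apply mul_le_mul h6 h5 _ (by norm_num)
              have := VV_nonneg k (2 ^ j)
              positivity
          _ ≤ _ := by linarith
      · have hj1 : j = 1 := by
          by_contra h; exact hz (Or.inl ⟨h2, by omega⟩)
        rw [hj1]
        have e1 : p ^ 1 = p := pow_one p
        have hV : VV k p ≤ (√p + 1) ^ (2 * k) * (p - 1 : ℝ) := by
          unfold VV
          have : ∀ a ∈ (Finset.univ : Finset (ZMod p)ˣ), ‖GS p a‖ ^ (2 * k) ≤ (√p + 1) ^ (2 * k) := by
            intro a _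
            exact pow_le_pow_left₀ (norm_nonneg _) (GS_prime_norm p h2 a) _
          refine (Finset.sum_le_card_nsmul _ _ _ this).trans ?_
          have hp1 := hpp.one_lt.le
          simp [ZMod.card_units_eq_totient, mul_comm, Nat.totient_prime hpp, Nat.cast_sub hp1]
        have hFp : F (p ^ 1) = (p : ℝ) ^ 2 * (w p ^ 2 * VV k p) := by rw [pow_one, hF']
        rw [hFp]
        have hp3 : (3 : ℝ) ≤ p := by
          have : 3 ≤ p := by have := hpp.two_le; omega
          exact_mod_cast this
        have hs : (5 : ℝ) / 3 ≤ √p := by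
          apply Real.le_sqrt_of_sq_le; linarith
        have hss : √(p : ℝ) ^ 2 = p := Real.sq_sqrt (by linarith)
        have hm := hMp p hpp h2
        calc _ ≤ (p : ℝ) ^ 2 * (w p ^ 2 * ((√p + 1) ^ (2 * k) * (p - 1 : ℝ))) := by gcongr
          _ = (p : ℝ) ^ 2 * (p - 1 : ℝ) * (|w p| * (√p + 1) ^ k) ^ 2 := by
            rw [mul_pow, sq_abs]; ring
          _ ≤ (p : ℝ) ^ 2 * (p - 1 : ℝ) * ((√p - 1)⁻¹ ^ 3) ^ 2 := by
            have : (0:ℝ) ≤ p - 1 := by linarith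
            gcongr
          _ = (√p) ^ 4 * ((√p) ^ 2 - 1) * ((√p - 1)⁻¹ ^ 3) ^ 2 := by
            rw [show (√(p:ℝ)) ^ 4 = ((√p) ^ 2) ^ 2 by ring, hss]
          _ ≤ _ := poly_bound hs

lemma Hyp2 : Hyp A2 (fun q a => (((((ArithmeticFunction.moebius q : ℤ) : ℝ) / ((Nat.totient q : ℝ)) ^ 2 : ℝ)) : ℂ)
    * Sqa q a ^ 1) 1100 := by
  set w : ℕ → ℝ := fun q => ((ArithmeticFunction.moebius q : ℤ) : ℝ) / ((Nat.totient q : ℝ)) ^ 2 with hw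
  have hA : A2 = AA 1 w := by
    funext n q
    simp only [A2, AA, pow_one, hw]
  rw [hA]
  have wp : ∀ p : ℕ, p.Prime → |w p| = ((p : ℝ) - 1)⁻¹ ^ 2 := by
    intro p hp
    simp only [hw]
    rw [ArithmeticFunction.moebius_apply_prime hp, Nat.totient_prime hp, Nat.cast_sub hp.one_lt.le]
    simp [abs_div]
  refine Hyp_AA 1 w le_rfl (by simp [hw]) ?_ ?_ ?_ ?_
  · intro m n h
    simp only [hw]
    rw [ArithmeticFunction.isMultiplicative_moebius.map_mul_of_coprime h, Nat.totient_mul h]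
    push_cast
    rw [mul_pow, mul_div_mul_comm]
  · intro q hq
    have h0 : (1 : ℝ) ≤ q.totient := by exact_mod_cast Nat.totient_pos.2 hq
    have h1 : |((ArithmeticFunction.moebius q : ℤ) : ℝ)| ≤ 1 := by
      have := @ArithmeticFunction.abs_moebius_le_one q
      exact_mod_cast this
    simp only [hw, pow_one]
    rw [abs_div, abs_of_pos (by positivity : (0:ℝ) < (q.totient : ℝ) ^ 2), div_mul_eq_mul_div, div_le_one (by positivity)]
    nlinarith
  · intro p hp h2 n
    rw [wp p hp.out]
    have hp3 : (3 : ℝ) ≤ p := by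
      have : 3 ≤ p := by have := hp.out.two_le; omega
      exact_mod_cast this
    have h1 := TT1_norm p h2 n
    have h5 : (0:ℝ) < p - 1 := by linarith
    calc _ ≤ ((p : ℝ) - 1)⁻¹ ^ 2 * (8 * p) := by gcongr
      _ ≤ _ := by
        rw [inv_pow, inv_mul_eq_div, div_le_div_iff₀ (by positivity) (by positivity)]
        nlinarith
  · intro p hp h2
    rw [wp p hp]
    have hp3 : (3 : ℝ) ≤ p := by
      have : 3 ≤ p := by have := hp.two_le; omega
      exact_mod_cast this
    have hs : (5 : ℝ) / 3 ≤ √p := by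
      apply Real.le_sqrt_of_sq_le; linarith
    have hss : √(p : ℝ) ^ 2 = p := Real.sq_sqrt (by linarith)
    rw [← hss, Real.sqrt_sq (by linarith)]
    set s := √(p : ℝ)
    have h5 : (0:ℝ) < s - 1 := by linarith
    have h6 : s ^ 2 - 1 = (s - 1) * (s + 1) := by ring
    rw [h6, pow_one, inv_pow, inv_pow, inv_mul_eq_div, div_le_iff₀ (by positivity), inv_mul_eq_div, le_div_iff₀ (by positivity)]
    have : (s - 1) ^ 2 * ((s + 1) * (s - 1)) ≤ (s + 1) ^ 2 * ((s + 1) * (s - 1)) := by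
      gcongr; linarith
    nlinarith [this]

lemma Hyp3 : Hyp A3 (fun q a => ((((((Nat.totient q : ℝ)) ^ 3)⁻¹ : ℝ)) : ℂ) * Sqa q a ^ 3) 1100 := by
  set w : ℕ → ℝ := fun q => (((Nat.totient q : ℝ)) ^ 3)⁻¹ with hw
  have hA : A3 = AA 3 w := by
    funext n q
    simp only [A3, AA, hw]
  rw [hA]
  have wp : ∀ p : ℕ, p.Prime → |w p| = ((p : ℝ) - 1)⁻¹ ^ 3 := by
    intro p hp
    have : (0:ℝ) ≤ p - 1 := by
      have := hp.one_lt.le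
      have : (1:ℝ) ≤ p := by exact_mod_cast this
      linarith
    simp only [hw]
    rw [Nat.totient_prime hp, Nat.cast_sub hp.one_lt.le, Nat.cast_one, inv_pow, abs_of_nonneg (by positivity)]
  refine Hyp_AA 3 w (by norm_num) (by simp [hw]) ?_ ?_ ?_ ?_
  · intro m n h
    simp only [hw]
    rw [Nat.totient_mul h]
    push_cast
    rw [mul_pow, mul_inv]
  · intro q hq
    have h0 : (1 : ℝ) ≤ q.totient := by exact_mod_cast Nat.totient_pos.2 hq
    simp only [hw]
    rw [abs_of_pos (by positivity), inv_mul_cancel₀ (by positivity)]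
  · intro p hp h2 n
    rw [wp p hp.out]
    have hp3 : (3 : ℝ) ≤ p := by
      have : 3 ≤ p := by have := hp.out.two_le; omega
      exact_mod_cast this
    have h1 := TT3_norm p h2 n
    have h5 : (0:ℝ) < p - 1 := by linarith
    calc _ ≤ ((p : ℝ) - 1)⁻¹ ^ 3 * (8 * p ^ 2) := by gcongr
      _ ≤ _ := by
        rw [inv_pow, inv_mul_eq_div, div_le_div_iff₀ (by positivity) (by positivity)]
        have : (p : ℝ) ^ 3 ≤ (2 * (p - 1)) ^ 3 := pow_le_pow_left₀ (by linarith) (by linarith) 3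
        nlinarith
  · intro p hp h2
    rw [wp p hp]
    have hp3 : (3 : ℝ) ≤ p := by
      have : 3 ≤ p := by have := hp.two_le; omega
      exact_mod_cast this
    have hs : (5 : ℝ) / 3 ≤ √p := by
      apply Real.le_sqrt_of_sq_le; linarith
    have hss : √(p : ℝ) ^ 2 = p := Real.sq_sqrt (by linarith)
    rw [← hss, Real.sqrt_sq (by linarith)]
    set s := √(p : ℝ)
    have h5 : (0:ℝ) < s - 1 := by linarith
    have h6 : s ^ 2 - 1 = (s - 1) * (s + 1) := by ring
    rw [h6, ← mul_pow]
    apply le_of_eq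
    congr 1
    field_simp

lemma primes_block (k : ℕ) (hk : 1 ≤ k) :
    ∑ p ∈ (Finset.Ico (2 ^ k) (2 ^ (k + 1))).filter Nat.Prime, (1 : ℝ) / p ≤ 4 / k := by
  set s := (Finset.Ico (2 ^ k) (2 ^ (k + 1))).filter Nat.Prime with hs
  have hk0 : (0 : ℝ) < k := by exact_mod_cast hk
  have h1 : ∑ p ∈ s, Real.log p ≤ Chebyshev.theta ((2 ^ (k + 1) : ℕ) : ℝ) := by
    rw [Chebyshev.theta_eq_sum_Icc, Nat.floor_natCast]
    refine Finset.sum_le_sum_of_subset_of_nonneg ?_ ?_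
    · intro p hp
      simp only [hs, Finset.mem_filter, Finset.mem_Ico, Finset.mem_Icc] at hp ⊢
      exact ⟨⟨by omega, by omega⟩, hp.2⟩
    · intro p _ _
      exact Real.log_natCast_nonneg p
  have h2 := Chebyshev.theta_le_log4_mul_x (x := ((2 ^ (k + 1) : ℕ) : ℝ)) (by positivity)
  have h3 : (s.card : ℝ) * (k * Real.log 2) ≤ ∑ p ∈ s, Real.log p := by
    rw [← nsmul_eq_mul]
    refine Finset.card_nsmul_le_sum _ _ _ fun p hp => ?_
    simp only [hs, Finset.mem_filter, Finset.mem_Ico] at hp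
    rw [← Real.log_pow]
    apply Real.log_le_log (by positivity)
    exact_mod_cast hp.1.1
  have hl4 : Real.log 4 = 2 * Real.log 2 := by
    rw [show (4 : ℝ) = 2 ^ 2 by norm_num, Real.log_pow]; norm_num
  have hl2 : 0 < Real.log 2 := Real.log_pos (by norm_num)
  have h4 : (s.card : ℝ) * k ≤ 2 ^ (k + 2) := by
    rw [hl4] at h2
    push_cast at h2
    have : (s.card : ℝ) * k * Real.log 2 ≤ 2 ^ (k + 2) * Real.log 2 := by
      calc _ = (s.card : ℝ) * (k * Real.log 2) := by ring
        _ ≤ 2 * Real.log 2 * 2 ^ (k + 1) := h3.trans (h1.trans (by simpa using h2))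
        _ = _ := by ring
    exact le_of_mul_le_mul_right this hl2
  have h5 : ∑ p ∈ s, (1 : ℝ) / p ≤ s.card * (1 / 2 ^ k) := by
    rw [← nsmul_eq_mul]
    refine Finset.sum_le_card_nsmul _ _ _ fun p hp => ?_
    simp only [hs, Finset.mem_filter, Finset.mem_Ico] at hp
    apply one_div_le_one_div_of_le (by positivity)
    exact_mod_cast hp.1.1
  refine h5.trans ?_
  rw [mul_one_div, div_le_div_iff₀ (by positivity) hk0]
  calc _ ≤ (2 : ℝ) ^ (k + 2) := h4
    _ = _ := by ring

lemma primes_dyadic (m : ℕ) :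
    ∑ p ∈ Nat.primesBelow (2 ^ (m + 1)), (1 : ℝ) / p ≤ 4 * ∑ k ∈ Finset.Icc 1 m, (1 : ℝ) / k := by
  induction m with
  | zero => simp [Nat.primesBelow]; rw [Finset.sum_eq_zero]; intro p hp; simp at hp; have := hp.2.two_le; omega
  | succ m ih =>
    rw [Finset.sum_Icc_succ_top (by omega), mul_add]
    have h1 : Nat.primesBelow (2 ^ (m + 1 + 1)) ⊆ Nat.primesBelow (2 ^ (m + 1)) ∪
        (Finset.Ico (2 ^ (m + 1)) (2 ^ (m + 1 + 1))).filter Nat.Prime := by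
      intro p hp
      simp only [Nat.primesBelow, Finset.mem_union, Finset.mem_filter, Finset.mem_range, Finset.mem_Ico] at hp ⊢
      rcases lt_or_ge p (2 ^ (m + 1)) with h | h
      · exact Or.inl ⟨h, hp.2⟩
      · exact Or.inr ⟨⟨h, hp.1⟩, hp.2⟩
    have h2 := primes_block (m + 1) (by omega)
    calc _ ≤ ∑ p ∈ Nat.primesBelow (2 ^ (m + 1)) ∪
        (Finset.Ico (2 ^ (m + 1)) (2 ^ (m + 1 + 1))).filter Nat.Prime, (1 : ℝ) / p :=
          Finset.sum_le_sum_of_subset_of_nonneg h1 (fun _ _ _ => by positivity)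
      _ ≤ ∑ p ∈ Nat.primesBelow (2 ^ (m + 1)), (1 : ℝ) / p +
        ∑ p ∈ (Finset.Ico (2 ^ (m + 1)) (2 ^ (m + 1 + 1))).filter Nat.Prime, (1 : ℝ) / p := by
          rw [← Finset.sum_union_inter]
          have : (0:ℝ) ≤ ∑ p ∈ Nat.primesBelow (2 ^ (m + 1)) ∩
            (Finset.Ico (2 ^ (m + 1)) (2 ^ (m + 1 + 1))).filter Nat.Prime, (1 : ℝ) / p :=
              Finset.sum_nonneg fun _ _ => by positivity
          linarith
      _ ≤ _ := by
        have : (4 : ℝ) / ((m + 1 : ℕ) : ℝ) = 4 * (1 / ((m + 1 : ℕ) : ℝ)) := by ring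
        linarith

lemma harm_le (m : ℕ) : ∑ k ∈ Finset.Icc 1 m, (1 : ℝ) / k ≤ 1 + Real.log m := by
  have := harmonic_le_one_add_log m
  rw [harmonic_eq_sum_Icc] at this
  push_cast at this
  simpa using this

lemma primes_recip (Q : ℝ) (hQ : 2 ≤ Q) :
    ∑ p ∈ Nat.primesBelow (⌊Q⌋₊ + 1), (1 : ℝ) / p ≤ 4 * (1 + Real.log (2 * Real.log Q)) := by
  set N := ⌊Q⌋₊
  have hN : 2 ≤ N := Nat.le_floor (by exact_mod_cast hQ)
  set m := Nat.log 2 N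
  have hm : 1 ≤ m := Nat.log_pos (by norm_num) hN
  have h1 : N < 2 ^ (m + 1) := Nat.lt_pow_succ_log_self (by norm_num) N
  have h2 : Nat.primesBelow (N + 1) ⊆ Nat.primesBelow (2 ^ (m + 1)) := by
    intro p hp
    simp only [Nat.primesBelow, Finset.mem_filter, Finset.mem_range] at hp ⊢
    exact ⟨by omega, hp.2⟩
  have h3 : (m : ℝ) ≤ 2 * Real.log Q := by
    have h4 : 2 ^ m ≤ N := Nat.pow_log_le_self 2 (by omega)
    have h5 : ((2 : ℝ) ^ m) ≤ Q := by
      calc ((2 : ℝ) ^ m) ≤ (N : ℝ) := by exact_mod_cast h4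
        _ ≤ Q := Nat.floor_le (by linarith)
    have h6 := Real.log_le_log (by positivity) h5
    rw [Real.log_pow] at h6
    have := Real.log_two_gt_d9
    have hm0 : (0:ℝ) ≤ m := by positivity
    nlinarith
  calc _ ≤ ∑ p ∈ Nat.primesBelow (2 ^ (m + 1)), (1 : ℝ) / p :=
        Finset.sum_le_sum_of_subset_of_nonneg h2 (fun _ _ _ => by positivity)
    _ ≤ 4 * ∑ k ∈ Finset.Icc 1 m, (1 : ℝ) / k := primes_dyadic m
    _ ≤ 4 * (1 + Real.log m) := by gcongr; exact harm_le m
    _ ≤ _ := by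
      have : Real.log m ≤ Real.log (2 * Real.log Q) :=
        Real.log_le_log (by exact_mod_cast hm) h3
      linarith

lemma sum_dvd_le (d Z : ℕ) (hd : 0 < d) :
    ∑ q ∈ (Finset.Icc 1 Z).filter (fun q => d ∣ q), (1 : ℝ) / q ≤ 1 / d * ∑ m ∈ Finset.Icc 1 Z, (1 : ℝ) / m := by
  have h1 : (Finset.Icc 1 Z).filter (fun q => d ∣ q) ⊆ (Finset.Icc 1 Z).image (fun m => d * m) := by
    intro q hq
    simp only [Finset.mem_filter, Finset.mem_Icc, Finset.mem_image] at hq ⊢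
    obtain ⟨⟨h1, h2⟩, m, rfl⟩ := hq
    refine ⟨m, ⟨?_, ?_⟩, rfl⟩
    · exact Nat.pos_of_ne_zero fun h => by simp [h] at h1
    · exact (Nat.le_mul_of_pos_left m hd).trans h2
  refine (Finset.sum_le_sum_of_subset_of_nonneg h1 (fun _ _ _ => by positivity)).trans ?_
  rw [Finset.sum_image (fun a _ b _ h => Nat.eq_of_mul_eq_mul_left hd h), Finset.mul_sum]
  refine le_of_eq (Finset.sum_congr rfl fun m _ => ?_)
  push_cast
  rw [one_div_mul_one_div]

lemma sumH (K : ℝ) (hK : 0 ≤ K) : ∃ C : ℝ, 0 < C ∧ ∀ Z : ℕ,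
    ∑ q ∈ Finset.Icc 1 Z, (∏ p ∈ q.primeFactors, (1 + K / √p)) * (1 / (q : ℝ)) ≤ C * (1 + Real.log Z) := by
  have hsum : Summable (fun n : ℕ => K * (1 / (n : ℝ) ^ (3 / 2 : ℝ))) :=
    (Real.summable_one_div_nat_rpow.2 (by norm_num)).mul_left K
  refine ⟨Real.exp (∑' n : ℕ, K * (1 / (n : ℝ) ^ (3 / 2 : ℝ))), Real.exp_pos _, fun Z => ?_⟩
  set S := (Finset.Icc 1 Z).filter Nat.Prime with hS
  set f : ℕ → ℝ := fun p => K / √p with hf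
  have hf0 : ∀ p, 0 ≤ f p := fun p => by simp only [hf]; positivity
  set HZ := ∑ m ∈ Finset.Icc 1 Z, (1 : ℝ) / m with hHZ
  have hHZ0 : 0 ≤ HZ := Finset.sum_nonneg fun _ _ => by positivity
  have step1 : ∀ q ∈ Finset.Icc 1 Z, (∏ p ∈ q.primeFactors, (1 + K / √p)) * (1 / (q : ℝ)) =
      ∑ D ∈ S.powerset, if D ⊆ q.primeFactors then (∏ p ∈ D, f p) * (1 / (q : ℝ)) else 0 := by
    intro q hq
    rw [Finset.prod_one_add, Finset.sum_mul, ← Finset.sum_filter]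
    refine Finset.sum_congr ?_ fun _ _ => rfl
    ext D
    simp only [Finset.mem_powerset, Finset.mem_filter]
    refine ⟨fun h => ⟨fun p hp => ?_, h⟩, fun h => h.2⟩
    have h1 := h hp
    have h2 := Nat.mem_primeFactors.1 h1
    simp only [hS, Finset.mem_filter, Finset.mem_Icc] at hq ⊢
    exact ⟨⟨h2.1.one_lt.le, (Nat.le_of_dvd (by omega) h2.2.1).trans hq.2⟩, h2.1⟩
  rw [Finset.sum_congr rfl step1, Finset.sum_comm]
  have step2 : ∀ D ∈ S.powerset, (∑ q ∈ Finset.Icc 1 Z,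
      if D ⊆ q.primeFactors then (∏ p ∈ D, f p) * (1 / (q : ℝ)) else 0) ≤
        (∏ p ∈ D, f p * (1 / (p : ℝ))) * HZ := by
    intro D hD
    rw [Finset.mem_powerset] at hD
    have hDp : ∀ p ∈ D, p.Prime := fun p hp => (Finset.mem_filter.1 (hD hp)).2
    rw [← Finset.sum_filter, ← Finset.mul_sum, Finset.prod_mul_distrib, mul_assoc]
    refine mul_le_mul_of_nonneg_left ?_ (Finset.prod_nonneg fun p _ => hf0 p)
    have h1 : (Finset.Icc 1 Z).filter (fun q => D ⊆ q.primeFactors) ⊆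
        (Finset.Icc 1 Z).filter (fun q => (∏ p ∈ D, p) ∣ q) := by
      intro q hq
      simp only [Finset.mem_filter] at hq ⊢
      exact ⟨hq.1, (Finset.prod_dvd_prod_of_subset _ _ _ hq.2).trans (Nat.prod_primeFactors_dvd q)⟩
    refine (Finset.sum_le_sum_of_subset_of_nonneg h1 (fun _ _ _ => by positivity)).trans ?_
    refine (sum_dvd_le _ Z (Finset.prod_pos fun p hp => (hDp p hp).pos)).trans ?_
    push_cast
    rw [Finset.prod_div_distrib, Finset.prod_const_one]
  refine (Finset.sum_le_sum step2).trans ?_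
  rw [← Finset.sum_mul, ← Finset.prod_one_add]
  refine mul_le_mul ?_ (harm_le Z) hHZ0 (Real.exp_pos _).le
  calc ∏ p ∈ S, (1 + f p * (1 / (p : ℝ))) ≤ ∏ p ∈ S, Real.exp (f p * (1 / (p : ℝ))) := by
        refine Finset.prod_le_prod (fun p _ => by have := hf0 p; positivity) fun p _ => ?_
        rw [add_comm]; exact Real.add_one_le_exp _
    _ = Real.exp (∑ p ∈ S, f p * (1 / (p : ℝ))) := (Real.exp_sum _ _).symm
    _ ≤ _ := by
      apply Real.exp_le_exp.2
      refine le_trans (le_of_eq ?_) (hsum.sum_le_tsum S (fun n _ => by positivity))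
      refine Finset.sum_congr rfl fun p hp => ?_
      have hp0 : (0:ℝ) < p := by
        exact_mod_cast (Finset.mem_filter.1 hp).2.pos
      simp only [hf]
      rw [show (3 / 2 : ℝ) = 1 / 2 + 1 by norm_num, Real.rpow_add hp0, Real.rpow_one, ← Real.sqrt_eq_rpow]
      field_simp

lemma geom_bound (ζ : ℂ) (L : ℕ) (hL : 0 < L) (h1 : ζ ≠ 1) (hζ : ζ ^ L = 1) (hn : ‖ζ‖ = 1) (a b : ℕ) :
    ‖∑ n ∈ Finset.Ioc a b, ζ ^ n‖ ≤ L := by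
  have : Finset.Ioc a b = Finset.Ico (a + 1) (b + 1) := by ext; simp
  rw [this, Finset.sum_Ico_eq_sum_range]
  simp only [pow_add _ (a + 1)]
  rw [← Finset.mul_sum, norm_mul, norm_pow, hn, one_pow, one_mul]
  set m := b + 1 - (a + 1)
  have h2 : ∑ i ∈ Finset.range m, ζ ^ i = ∑ i ∈ Finset.range (m % L), ζ ^ i := by
    rw [geom_sum_eq h1, geom_sum_eq h1]
    congr 2
    conv_lhs => rw [← Nat.div_add_mod m L, pow_add, pow_mul, hζ, one_pow, one_mul]
  rw [h2]
  refine (norm_sum_le _ _).trans ?_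
  simp only [norm_pow, hn, one_pow, Finset.sum_const, Finset.card_range, nsmul_eq_mul, mul_one]
  exact_mod_cast (Nat.mod_lt m hL).le

lemma e_norm (x : ℝ) : ‖e x‖ = 1 := by
  unfold e
  rw [show (2 * Real.pi * Complex.I * x : ℂ) = ((2 * Real.pi * x : ℝ) : ℂ) * Complex.I by push_cast; ring]
  exact Complex.norm_exp_ofReal_mul_I _

lemma e_add (x y : ℝ) : e (x + y) = e x * e y := by
  unfold e; rw [← Complex.exp_add]; congr 1; push_cast; ring

lemma e_conj (x : ℝ) : (starRingEnd ℂ) (e x) = e (-x) := by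
  unfold e; rw [← Complex.exp_conj]; congr 1; simp only [map_mul, Complex.conj_ofReal, Complex.conj_I, map_ofNat, Complex.ofReal_neg]; ring

lemma e_nsmul (x : ℝ) (n : ℕ) : e (x * n) = e x ^ n := by
  unfold e; rw [← Complex.exp_nat_mul]; congr 1; push_cast; ring

lemma e_int (j : ℤ) : e j = 1 := by
  unfold e
  rw [Complex.exp_eq_one_iff]
  exact ⟨j, by push_cast; ring⟩

lemma e_eq_one {x : ℝ} (h : e x = 1) : ∃ j : ℤ, x = j := by
  unfold e at h
  rw [Complex.exp_eq_one_iff] at h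
  obtain ⟨j, hj⟩ := h
  refine ⟨j, ?_⟩
  have h2 : (2 * Real.pi * Complex.I : ℂ) ≠ 0 := Complex.two_pi_I_ne_zero
  have : (x : ℂ) = j := by
    apply mul_left_cancel₀ h2
    rw [hj]; ring
  exact_mod_cast this

lemma frac_inj {q a q' a' : ℕ} (ha : 1 ≤ a) (haq : a ≤ q) (hg : Nat.gcd a q = 1)
    (ha' : 1 ≤ a') (haq' : a' ≤ q') (hg' : Nat.gcd a' q' = 1)
    (h : e (-((a : ℝ) / q) + (a' : ℝ) / q') = 1) : q = q' ∧ a = a' := by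
  obtain ⟨j, hj⟩ := e_eq_one h
  have hq : (0:ℝ) < q := by exact_mod_cast (by omega : 0 < q)
  have hq' : (0:ℝ) < q' := by exact_mod_cast (by omega : 0 < q')
  have b1 : 0 < (a : ℝ) / q := by have : (0:ℝ) < a := by exact_mod_cast ha
                                  positivity
  have b2 : (a : ℝ) / q ≤ 1 := by rw [div_le_one hq]; exact_mod_cast haq
  have b1' : 0 < (a' : ℝ) / q' := by have : (0:ℝ) < a' := by exact_mod_cast ha'
                                     positivity
  have b2' : (a' : ℝ) / q' ≤ 1 := by rw [div_le_one hq']; exact_mod_cast haq'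
  have j1 : (j : ℝ) < 1 := by linarith
  have j2 : (-1 : ℝ) < j := by linarith
  have j0 : j = 0 := by
    have j1' : j < 1 := by exact_mod_cast j1
    have j2' : -1 < j := by exact_mod_cast j2
    omega
  subst j0
  have h3 : (a : ℝ) / q = (a' : ℝ) / q' := by
    push_cast at hj; linarith
  rw [div_eq_div_iff hq.ne' hq'.ne'] at h3
  have h4 : a * q' = a' * q := by exact_mod_cast h3
  have d1 : q ∣ q' := by
    have : q ∣ a * q' := ⟨a', by rw [h4]; ring⟩
    exact (Nat.Coprime.symm hg).dvd_of_dvd_mul_left this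
  have d2 : q' ∣ q := by
    have : q' ∣ a' * q := ⟨a, by rw [← h4]; ring⟩
    exact (Nat.Coprime.symm hg').dvd_of_dvd_mul_left this
  have hqq := Nat.dvd_antisymm d1 d2
  subst hqq
  exact ⟨rfl, Nat.eq_of_mul_eq_mul_right (by omega) h4⟩

lemma ls_abs {ι : Type} (T : Finset ι) (c : ι → ℂ) (θ : ι → ℝ) (N1 N2 : ℕ) (B : ℝ) (hB : 0 ≤ B)
    (hoff : ∀ s ∈ T, ∀ t ∈ T, s ≠ t → ‖∑ n ∈ Finset.Ioc N1 N2, e (θ s - θ t) ^ n‖ ≤ B) :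
    ∑ n ∈ Finset.Ioc N1 N2, ‖∑ t ∈ T, c t * e (θ t * (n : ℝ))‖ ^ 2 ≤
      (((N2 - N1 : ℕ) : ℝ) + B * T.card) * ∑ t ∈ T, ‖c t‖ ^ 2 := by
  set M : ℝ := ((N2 - N1 : ℕ) : ℝ) with hM
  have h1 : ((∑ n ∈ Finset.Ioc N1 N2, ‖∑ t ∈ T, c t * e (θ t * (n : ℝ))‖ ^ 2 : ℝ) : ℂ) =
      ∑ s ∈ T, ∑ t ∈ T, (c s * (starRingEnd ℂ) (c t)) * ∑ n ∈ Finset.Ioc N1 N2, e (θ s - θ t) ^ n := by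
    push_cast
    have : ∀ n ∈ Finset.Ioc N1 N2, ((‖∑ t ∈ T, c t * e (θ t * (n : ℝ))‖ : ℂ) ^ 2) =
        ∑ s ∈ T, ∑ t ∈ T, (c s * (starRingEnd ℂ) (c t)) * e (θ s - θ t) ^ n := by
      intro n _
      rw [← Complex.mul_conj', map_sum, Finset.sum_mul_sum]
      refine Finset.sum_congr rfl fun s _ => Finset.sum_congr rfl fun t _ => ?_
      rw [map_mul, e_conj, ← e_nsmul, sub_mul, sub_eq_add_neg, e_add]
      ring
    rw [Finset.sum_congr rfl this, Finset.sum_comm]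
    refine Finset.sum_congr rfl fun s _ => ?_
    rw [Finset.sum_comm]
    refine Finset.sum_congr rfl fun t _ => ?_
    rw [Finset.mul_sum]
  have h0 : 0 ≤ ∑ n ∈ Finset.Ioc N1 N2, ‖∑ t ∈ T, c t * e (θ t * (n : ℝ))‖ ^ 2 :=
    Finset.sum_nonneg fun _ _ => by positivity
  have h2 : ∑ n ∈ Finset.Ioc N1 N2, ‖∑ t ∈ T, c t * e (θ t * (n : ℝ))‖ ^ 2 ≤
      ∑ s ∈ T, ∑ t ∈ T, (‖c s‖ * ‖c t‖ * B + if s = t then M * ‖c s‖ ^ 2 else 0) := by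
    rw [← Real.norm_of_nonneg h0, ← Complex.norm_real, h1]
    refine norm_sum_le_of_le _ fun s hs => norm_sum_le_of_le _ fun t ht => ?_
    rw [norm_mul, norm_mul, RCLike.norm_conj]
    by_cases hst : s = t
    · subst hst
      rw [if_pos rfl, sub_self]
      have : e 0 = 1 := by simpa using e_int 0
      have h5 : ‖∑ n ∈ Finset.Ioc N1 N2, e 0 ^ n‖ = M := by
        rw [this]; simp [hM]
      rw [h5]
      have : 0 ≤ ‖c s‖ * ‖c s‖ * B := by positivity
      nlinarith
    · rw [if_neg hst, add_zero]
      exact mul_le_mul_of_nonneg_left (hoff s hs t ht hst) (by positivity)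
  refine h2.trans ?_
  have h3 : ∑ s ∈ T, ∑ t ∈ T, (‖c s‖ * ‖c t‖ * B + if s = t then M * ‖c s‖ ^ 2 else 0) =
      B * (∑ s ∈ T, ‖c s‖) ^ 2 + M * ∑ s ∈ T, ‖c s‖ ^ 2 := by
    simp only [Finset.sum_add_distrib]
    congr 1
    · rw [sq, Finset.sum_mul_sum, Finset.mul_sum]
      refine Finset.sum_congr rfl fun s _ => ?_
      rw [Finset.mul_sum]
      exact Finset.sum_congr rfl fun t _ => by ring
    · rw [Finset.mul_sum]
      refine Finset.sum_congr rfl fun s hs => ?_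
      rw [Finset.sum_ite_eq, if_pos hs]
  rw [h3]
  have h4 : (∑ s ∈ T, ‖c s‖) ^ 2 ≤ T.card * ∑ s ∈ T, ‖c s‖ ^ 2 := sq_sum_le_card_mul_sum_sq
  have := mul_le_mul_of_nonneg_left h4 hB
  linarith

lemma ls_hyp {A b : ℕ → ℕ → ℂ} {K : ℝ} (H : Hyp A b K) (R : Finset ℕ) (Z : ℕ)
    (hR : R ⊆ Finset.Icc 1 Z) (N1 N2 : ℕ) :
    ∑ n ∈ Finset.Ioc N1 N2, ‖∑ q ∈ R, A n q‖ ^ 2 ≤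
      (((N2 - N1 : ℕ) : ℝ) + (Z : ℝ) ^ 4) * ∑ q ∈ R, (∏ p ∈ q.primeFactors, (1 + K / √p)) / (q : ℝ) ^ 2 := by
  set g : ℕ → Finset ℕ := fun q => (Finset.Icc 1 q).filter (fun a => Nat.gcd a q = 1) with hg
  set T : Finset (Σ _ : ℕ, ℕ) := R.sigma g with hT
  have hmem : ∀ t ∈ T, 1 ≤ t.1 ∧ t.1 ≤ Z ∧ 1 ≤ t.2 ∧ t.2 ≤ t.1 ∧ Nat.gcd t.2 t.1 = 1 := by
    intro t ht
    rw [hT, Finset.mem_sigma] at ht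
    have h1 := Finset.mem_Icc.1 (hR ht.1)
    have h2 := Finset.mem_filter.1 ht.2
    have h3 := Finset.mem_Icc.1 h2.1
    exact ⟨h1.1, h1.2, h3.1, h3.2, h2.2⟩
  have key := ls_abs T (fun t => b t.1 t.2) (fun t => -((t.2 : ℝ) / t.1)) N1 N2 ((Z : ℝ) ^ 2) (by positivity) (by
    intro s hs t ht hst
    obtain ⟨s1, s2, s3, s4, s5⟩ := hmem s hs
    obtain ⟨t1, t2, t3, t4, t5⟩ := hmem t ht
    have hs0 : (s.1 : ℝ) ≠ 0 := by exact_mod_cast (by omega : s.1 ≠ 0)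
    have ht0 : (t.1 : ℝ) ≠ 0 := by exact_mod_cast (by omega : t.1 ≠ 0)
    have hz : e (-((s.2 : ℝ) / s.1) - -((t.2 : ℝ) / t.1)) = e (-((s.2 : ℝ) / s.1) + ((t.2 : ℝ) / t.1)) := by
      congr 1; ring
    simp only [hz]
    refine (geom_bound _ (s.1 * t.1) (Nat.mul_pos s1 t1) ?_ ?_ (e_norm _) N1 N2).trans ?_
    · intro h
      obtain ⟨h1, h2⟩ := frac_inj s3 s4 s5 t3 t4 t5 h
      apply hst
      cases s; cases t; simp_all
    · rw [← e_nsmul]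
      rw [show (-((s.2 : ℝ) / s.1) + ((t.2 : ℝ) / t.1)) * ((s.1 * t.1 : ℕ) : ℝ) =
        ((-(s.2 : ℤ) * t.1 + t.2 * s.1 : ℤ) : ℝ) by push_cast; field_simp]
      exact e_int _
    · push_cast
      rw [sq]
      have a1 : (s.1 : ℝ) ≤ Z := by exact_mod_cast s2
      have a2 : (t.1 : ℝ) ≤ Z := by exact_mod_cast t2
      gcongr)
  have hcard : (T.card : ℝ) ≤ (Z : ℝ) ^ 2 := by
    have : T.card ≤ Z ^ 2 := by
      rw [hT, Finset.card_sigma]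
      calc ∑ q ∈ R, (g q).card ≤ ∑ q ∈ R, Z := by
            refine Finset.sum_le_sum fun q hq => ?_
            refine (Finset.card_filter_le _ _).trans ?_
            simpa using (Finset.mem_Icc.1 (hR hq)).2
        _ = R.card * Z := by simp
        _ ≤ Z * Z := by
          gcongr
          simpa using Finset.card_le_card hR
        _ = Z ^ 2 := by ring
    exact_mod_cast this
  have hs : ∀ n, ∑ q ∈ R, A n q = ∑ t ∈ T, b t.1 t.2 * e (-((t.2 : ℝ) / t.1) * (n : ℝ)) := by
    intro n
    rw [hT, Finset.sum_sigma]
    refine Finset.sum_congr rfl fun q hq => ?_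
    rw [H.hA n q (Finset.mem_Icc.1 (hR hq)).1]
    refine Finset.sum_congr rfl fun a _ => ?_
    congr 2; ring
  simp only [hs]
  refine key.trans ?_
  refine mul_le_mul ?_ ?_ (Finset.sum_nonneg fun _ _ => by positivity) (by positivity)
  · have := mul_le_mul_of_nonneg_left hcard (by positivity : 0 ≤ (Z:ℝ)^2)
    nlinarith
  · rw [hT, Finset.sum_sigma]
    refine Finset.sum_le_sum fun q hq => ?_
    have hq1 := (Finset.mem_Icc.1 (hR hq)).1
    have hq0 : (0:ℝ) < q := by exact_mod_cast hq1
    rw [le_div_iff₀ (by positivity), mul_comm]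
    exact H.hM q hq1

lemma core1 {A b : ℕ → ℕ → ℂ} {K : ℝ} (H : Hyp A b K) : ∃ C : ℝ, 0 < C ∧
    ∀ (R : Finset ℕ) (Z : ℕ) (P : ℝ), 0 < P → R ⊆ Finset.Icc 1 Z → (∀ q ∈ R, P ≤ q) → ∀ (N1 N2 : ℕ),
    ∑ n ∈ Finset.Ioc N1 N2, ‖∑ q ∈ R, A n q‖ ^ 2 ≤
      (((N2 - N1 : ℕ) : ℝ) + (Z : ℝ) ^ 4) * (P⁻¹ * (C * (1 + Real.log Z))) := by
  have hK0 : 0 ≤ K := by linarith [H.hK]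
  obtain ⟨C, hC, hs⟩ := sumH K hK0
  refine ⟨C, hC, fun R Z P hP hR hRP N1 N2 => ?_⟩
  refine (ls_hyp H R Z hR N1 N2).trans ?_
  refine mul_le_mul_of_nonneg_left ?_ (by positivity)
  calc _ ≤ ∑ q ∈ R, P⁻¹ * ((∏ p ∈ q.primeFactors, (1 + K / √p)) * (1 / (q : ℝ))) := by
        refine Finset.sum_le_sum fun q hq => ?_
        have h1 := hRP q hq
        have hq0 : (0:ℝ) < q := by linarith
        have h2 : (q:ℝ)⁻¹ ≤ P⁻¹ := by gcongr
        have h3 : 0 ≤ (∏ p ∈ q.primeFactors, (1 + K / √p)) * (1 / (q : ℝ)) := by positivity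
        calc _ = (q:ℝ)⁻¹ * ((∏ p ∈ q.primeFactors, (1 + K / √p)) * (1 / (q : ℝ))) := by
              field_simp
          _ ≤ _ := by gcongr
    _ ≤ P⁻¹ * ∑ q ∈ Finset.Icc 1 Z, ((∏ p ∈ q.primeFactors, (1 + K / √p)) * (1 / (q : ℝ))) := by
        rw [← Finset.mul_sum]
        refine mul_le_mul_of_nonneg_left ?_ (by positivity)
        exact Finset.sum_le_sum_of_subset_of_nonneg hR (fun _ _ _ => by positivity)
    _ ≤ _ := by gcongr; exact hs Z
lemma pow_hasSum {R : Type} [NormedRing R] {f : ℕ → R} (hz : ∀ k, 4 ≤ k → f k = 0) :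
    HasSum f (∑ k ∈ Finset.range 4, f k) :=
  hasSum_sum_of_ne_finset_zero fun k hk => hz k (by simpa using hk)

lemma PP_hasSum {A b : ℕ → ℕ → ℂ} {K : ℝ} (H : Hyp A b K) (n : ℕ) (N : ℕ) :
    HasSum (fun m : N.smoothNumbers => A n m)
      (∏ p ∈ (Finset.Icc 1 (N - 1)).filter Nat.Prime, (1 + ∑' k : ℕ, A n (p ^ (k + 1)))) := by
  have h := (EulerProduct.summable_and_hasSum_smoothNumbers_prod_primesBelow_tsum (f := A n)
    (H.one n) (fun h => H.mul n h) (fun {p} hp =>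
      (pow_hasSum (f := fun k => ‖A n (p ^ k)‖) (fun k hk => by simp [H.pz n p k hp hk])).summable) N).2
  suffices heq : (∏ p ∈ (Finset.Icc 1 (N - 1)).filter Nat.Prime, (1 + ∑' k : ℕ, A n (p ^ (k + 1)))) =
      ∏ p ∈ N.primesBelow, ∑' k : ℕ, A n (p ^ k) by
    rw [heq]; exact h
  have : (Finset.Icc 1 (N - 1)).filter Nat.Prime = N.primesBelow := by
    ext p
    simp only [Nat.primesBelow, Finset.mem_filter, Finset.mem_Icc, Finset.mem_range]
    constructor
    · rintro ⟨⟨h1, h2⟩, h3⟩; exact ⟨by omega, h3⟩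
    · rintro ⟨h1, h3⟩; have := h3.two_le; exact ⟨⟨by omega, by omega⟩, h3⟩
  rw [this]
  refine Finset.prod_congr rfl fun p hp => ?_
  have hp' : p.Prime := (Finset.mem_filter.1 hp).2
  have hs := (pow_hasSum (f := fun k => A n (p ^ k)) (fun k hk => H.pz n p k hp' hk)).summable
  rw [hs.tsum_eq_zero_add, pow_zero, H.one]

lemma rankin_hasSum {A b : ℕ → ℕ → ℂ} {K : ℝ} (H : Hyp A b K) (n : ℕ) (Q : ℝ) (hQ : 2 ≤ Q) :
    ∃ S : ℝ, S ≤ Real.exp (12 * Real.exp 3 * K * (1 + Real.log (2 * Real.log Q))) ∧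
    HasSum (fun m : (⌊Q⌋₊ + 1).smoothNumbers => ((m : ℕ) : ℝ) ^ (1 / Real.log Q) * ‖A n m‖) S := by
  have hlQ : 0 < Real.log Q := Real.log_pos (by linarith)
  set σ := 1 / Real.log Q with hσ
  set f : ℕ → ℝ := fun m => (m : ℝ) ^ σ * ‖A n m‖ with hf
  have hK := H.hK
  have hz : ∀ p, p.Prime → ∀ k, 4 ≤ k → f (p ^ k) = 0 := fun p hp k hk => by
    simp [hf, H.pz n p k hp hk]
  have hf1 : f 1 = 1 := by simp [hf, H.one]
  have h := (EulerProduct.summable_and_hasSum_smoothNumbers_prod_primesBelow_tsum (f := f)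
    hf1 (fun {m m'} h => by
      simp only [hf]
      rw [H.mul n h, norm_mul, Nat.cast_mul, Real.mul_rpow (by positivity) (by positivity)]; ring) (fun {p} hp =>
      (pow_hasSum (f := fun k => ‖f (p ^ k)‖) (fun k hk => by rw [hz p hp k hk, norm_zero])).summable) (⌊Q⌋₊ + 1)).2
  refine ⟨_, ?_, h⟩
  have hb : ∀ p ∈ (⌊Q⌋₊ + 1).primesBelow, ∑' k : ℕ, f (p ^ k) ≤ Real.exp (3 * Real.exp 3 * K * (1 / (p : ℝ))) := by
    intro p hp
    have hp' : p.Prime := (Finset.mem_filter.1 hp).2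
    have hpN : p ≤ ⌊Q⌋₊ := by have := Finset.mem_range.1 (Finset.mem_filter.1 hp).1; omega
    have hpQ : (p : ℝ) ≤ Q := (Nat.cast_le.2 hpN).trans (Nat.floor_le (by linarith))
    have hp0 : (0:ℝ) < p := by exact_mod_cast hp'.pos
    rw [(pow_hasSum (f := fun k => f (p ^ k)) (hz p hp')).tsum_eq]
    have hk : ∀ k, 1 ≤ k → k ≤ 3 → f (p ^ k) ≤ Real.exp 3 * (K / p) := by
      intro k h1 h3
      simp only [hf]
      refine mul_le_mul ?_ (H.pp n p k hp' h1) (norm_nonneg _) (Real.exp_pos _).le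
      push_cast
      rw [Real.rpow_def_of_pos (by positivity), Real.log_pow]
      apply Real.exp_le_exp.2
      have hl : Real.log p ≤ Real.log Q := Real.log_le_log hp0 hpQ
      rw [hσ, mul_one_div, div_le_iff₀ hlQ]
      have hl0 : 0 ≤ Real.log p := Real.log_natCast_nonneg p
      have : (k:ℝ) ≤ 3 := by exact_mod_cast h3
      nlinarith
    have e1 := hk 1 le_rfl (by norm_num)
    have e2 := hk 2 (by norm_num) (by norm_num)
    have e3 := hk 3 (by norm_num) (by norm_num)
    have e4 := Real.add_one_le_exp (3 * Real.exp 3 * K * (1 / (p : ℝ)))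
    simp only [Finset.sum_range_succ, Finset.sum_range_zero, pow_zero, hf1]
    have : 3 * (Real.exp 3 * (K / p)) = 3 * Real.exp 3 * K * (1 / (p : ℝ)) := by ring
    linarith
  calc _ ≤ ∏ p ∈ (⌊Q⌋₊ + 1).primesBelow, Real.exp (3 * Real.exp 3 * K * (1 / (p : ℝ))) := by
        refine Finset.prod_le_prod (fun p _ => tsum_nonneg fun k => by positivity) hb
    _ = Real.exp (3 * Real.exp 3 * K * ∑ p ∈ Nat.primesBelow (⌊Q⌋₊ + 1), 1 / (p : ℝ)) := by
        rw [← Real.exp_sum, Finset.mul_sum]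
    _ ≤ _ := by
      apply Real.exp_le_exp.2
      have := mul_le_mul_of_nonneg_left (primes_recip Q hQ) (by positivity : 0 ≤ 3 * Real.exp 3 * K)
      linarith

lemma tail {A b : ℕ → ℕ → ℂ} {K : ℝ} (H : Hyp A b K) (n : ℕ) (P Q z : ℝ) (hP : 2 ≤ P) (hPQ : P ≤ Q) (hz : 0 < z) :
    ‖(∑ q ∈ Finset.Icc 1 ⌊P⌋₊, A n q) - ∏ p ∈ (Finset.Icc 1 ⌊Q⌋₊).filter Nat.Prime, (1 + ∑' k : ℕ, A n (p ^ (k + 1)))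
      + ∑ q ∈ (Finset.Ioc ⌊P⌋₊ ⌊z⌋₊).filter (fun q => q ∈ (⌊Q⌋₊ + 1).smoothNumbers), A n q‖ ≤
      Real.exp (-(Real.log z / Real.log Q)) * Real.exp (12 * Real.exp 3 * K * (1 + Real.log (2 * Real.log Q))) := by
  have hQ : 2 ≤ Q := hP.trans hPQ
  have hlQ : 0 < Real.log Q := Real.log_pos (by linarith)
  obtain ⟨S, hS, hsum⟩ := rankin_hasSum H n Q hQ
  have hpp := PP_hasSum H n (⌊Q⌋₊ + 1)
  rw [Nat.add_sub_cancel] at hpp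
  set PPv := ∏ p ∈ (Finset.Icc 1 ⌊Q⌋₊).filter Nat.Prime, (1 + ∑' k : ℕ, A n (p ^ (k + 1)))
  set N := ⌊Q⌋₊ + 1 with hN
  set sm := N.smoothNumbers with hsm
  set R := (Finset.Ioc ⌊P⌋₊ ⌊z⌋₊).filter (fun q => q ∈ sm) with hR
  set F := Finset.Icc 1 ⌊P⌋₊ ∪ R with hF
  have hdis : Disjoint (Finset.Icc 1 ⌊P⌋₊) R := by
    rw [Finset.disjoint_left]
    intro q h1 h2
    simp only [hR, Finset.mem_filter, Finset.mem_Ioc, Finset.mem_Icc] at h1 h2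
    omega
  have hPQf : ⌊P⌋₊ ≤ ⌊Q⌋₊ := Nat.floor_mono hPQ
  have hFs : ∀ m ∈ F, m ∈ sm := by
    intro m hm
    rw [hF, Finset.mem_union] at hm
    rcases hm with hm | hm
    · rw [Finset.mem_Icc] at hm
      exact Nat.mem_smoothNumbers_of_lt (by omega) (by omega)
    · exact (Finset.mem_filter.1 hm).2
  have hout : ∀ m ∈ sm, m ∉ F → z ≤ m := by
    intro m hm hmF
    have hm0 := Nat.ne_zero_of_mem_smoothNumbers hm
    simp only [hF, hR, Finset.mem_union, Finset.mem_filter, Finset.mem_Icc, Finset.mem_Ioc, not_or, not_and] at hmF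
    by_contra hlt
    push Not at hlt
    have h1 : m ≤ ⌊z⌋₊ := Nat.le_floor hlt.le
    have h2 : ⌊P⌋₊ < m := by
      by_contra hh
      exact hmF.1 (by omega) (by omega)
    exact hmF.2 ⟨h2, h1⟩ hm
  have hpp2 : HasSum (sm.indicator (A n)) PPv := (hasSum_subtype_iff_indicator (f := A n)).1 hpp
  have hsum2 : HasSum (sm.indicator (fun m : ℕ => (m : ℝ) ^ (1 / Real.log Q) * ‖A n m‖)) S :=
    (hasSum_subtype_iff_indicator (f := fun m : ℕ => (m : ℝ) ^ (1 / Real.log Q) * ‖A n m‖)).1 hsum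
  have hfin : HasSum (fun m => if m ∈ F then A n m else 0) (∑ m ∈ F, A n m) := by
    have := hasSum_sum_of_ne_finset_zero (L := SummationFilter.unconditional ℕ) (f := fun m => if m ∈ F then A n m else 0) (s := F)
      (fun m hm => if_neg hm)
    rwa [Finset.sum_congr rfl (fun m hm => if_pos hm)] at this
  have hd := hfin.sub hpp2
  have hscal := hsum2.mul_left (Real.exp (-(Real.log z / Real.log Q)))
  have hbd := hd.norm_le_of_bounded hscal (by
    intro m
    by_cases hmF : m ∈ F
    · rw [if_pos hmF, Set.indicator_of_mem (hFs m hmF), sub_self, norm_zero]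
      refine mul_nonneg (Real.exp_pos _).le ?_
      exact Set.indicator_nonneg (fun _ _ => by positivity) _
    · rw [if_neg hmF, zero_sub, norm_neg]
      by_cases hms : m ∈ sm
      · rw [Set.indicator_of_mem hms, Set.indicator_of_mem hms, ← mul_assoc]
        refine le_mul_of_one_le_left (norm_nonneg _) ?_
        have hzm := hout m hms hmF
        have hm0 : (0:ℝ) < m := by linarith
        rw [Real.rpow_def_of_pos hm0, ← Real.exp_add]
        apply Real.one_le_exp
        have := Real.log_le_log hz hzm
        have : Real.log z / Real.log Q ≤ Real.log m / Real.log Q := by gcongr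
        rw [mul_one_div]; linarith
      · rw [Set.indicator_of_notMem hms, Set.indicator_of_notMem hms]; simp)
  rw [hF, Finset.sum_union hdis] at hbd
  calc _ = _ := by congr 1; ring
    _ ≤ _ := hbd
    _ ≤ _ := by gcongr

lemma core {A b : ℕ → ℕ → ℂ} {K : ℝ} (H : Hyp A b K) : ∃ C : ℝ, 0 < C ∧
    ∀ (P Q z : ℝ), 2 ≤ P → P ≤ Q → 1 ≤ z → ∀ (N1 N2 : ℕ),
    ∑ n ∈ Finset.Ioc N1 N2, ‖(∑ q ∈ Finset.Icc 1 ⌊P⌋₊, A n q) -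
        ∏ p ∈ (Finset.Icc 1 ⌊Q⌋₊).filter Nat.Prime, (1 + ∑' k : ℕ, A n (p ^ (k + 1)))‖ ^ 2 ≤
      2 * ((((N2 - N1 : ℕ) : ℝ) + z ^ 4) * (P⁻¹ * (C * (1 + Real.log z)))) +
      2 * (((N2 - N1 : ℕ) : ℝ) * (Real.exp (-(Real.log z / Real.log Q)) *
        Real.exp (12 * Real.exp 3 * K * (1 + Real.log (2 * Real.log Q)))) ^ 2) := by
  obtain ⟨C, hC, hc⟩ := core1 H
  refine ⟨C, hC, fun P Q z hP hPQ hz N1 N2 => ?_⟩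
  set E := Real.exp (-(Real.log z / Real.log Q)) *
        Real.exp (12 * Real.exp 3 * K * (1 + Real.log (2 * Real.log Q))) with hE
  have hE0 : 0 ≤ E := by positivity
  set R := (Finset.Ioc ⌊P⌋₊ ⌊z⌋₊).filter (fun q => q ∈ (⌊Q⌋₊ + 1).smoothNumbers) with hR
  have h1 := hc R ⌊z⌋₊ P (by linarith) (by
    intro q hq
    simp only [hR, Finset.mem_filter, Finset.mem_Ioc, Finset.mem_Icc] at hq ⊢
    omega) (by
    intro q hq
    simp only [hR, Finset.mem_filter, Finset.mem_Ioc] at hq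
    exact (Nat.lt_of_floor_lt hq.1.1).le) N1 N2
  have hZ1 : (1:ℝ) ≤ (⌊z⌋₊ : ℝ) := by exact_mod_cast (Nat.one_le_floor_iff z).2 hz
  have hZz : (⌊z⌋₊ : ℝ) ≤ z := Nat.floor_le (by linarith)
  have hlz : Real.log ⌊z⌋₊ ≤ Real.log z := Real.log_le_log (by linarith) hZz
  have hlz0 : 0 ≤ Real.log ⌊z⌋₊ := Real.log_nonneg hZ1
  have hPi : 0 < P⁻¹ := by have : 0 < P := by linarith
                           positivity
  have h2 : (((N2 - N1 : ℕ) : ℝ) + (⌊z⌋₊ : ℝ) ^ 4) * (P⁻¹ * (C * (1 + Real.log ⌊z⌋₊))) ≤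
      (((N2 - N1 : ℕ) : ℝ) + z ^ 4) * (P⁻¹ * (C * (1 + Real.log z))) := by
    gcongr
  have h3 : ∀ n ∈ Finset.Ioc N1 N2, ‖(∑ q ∈ Finset.Icc 1 ⌊P⌋₊, A n q) -
        ∏ p ∈ (Finset.Icc 1 ⌊Q⌋₊).filter Nat.Prime, (1 + ∑' k : ℕ, A n (p ^ (k + 1)))‖ ^ 2 ≤
        2 * ‖∑ q ∈ R, A n q‖ ^ 2 + 2 * E ^ 2 := by
    intro n _
    have ht := tail H n P Q z hP hPQ (by linarith)
    rw [← hR, ← hE] at ht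
    set u := (∑ q ∈ Finset.Icc 1 ⌊P⌋₊, A n q) -
        ∏ p ∈ (Finset.Icc 1 ⌊Q⌋₊).filter Nat.Prime, (1 + ∑' k : ℕ, A n (p ^ (k + 1)))
    set v := ∑ q ∈ R, A n q
    have : ‖u‖ ≤ ‖v‖ + E := by
      calc ‖u‖ = ‖(u + v) - v‖ := by congr 1; ring
        _ ≤ ‖u + v‖ + ‖v‖ := norm_sub_le _ _
        _ ≤ _ := by linarith
    nlinarith [norm_nonneg u, norm_nonneg v, sq_nonneg (‖v‖ - E)]
  refine (Finset.sum_le_sum h3).trans ?_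
  rw [Finset.sum_add_distrib, ← Finset.mul_sum, Finset.sum_const, Nat.card_Ioc, nsmul_eq_mul]
  linarith
lemma ev_bound (c A ε : ℝ) (hε : 0 < ε) : ∃ x₀ : ℝ, ∀ x, x₀ ≤ x → 1 ≤ Real.log x ∧
    Real.log x ^ (2 * c) * Real.exp (-(ε / 2) * Real.log x ^ ε) ≤ Real.log x ^ (-A) := by
  have h1 := tendsto_rpow_mul_exp_neg_mul_atTop_nhds_zero ((2 * c + A) / ε) (ε / 2) (by positivity)
  have h2 := h1.comp ((tendsto_rpow_atTop hε).comp Real.tendsto_log_atTop)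
  have h3 := h2.eventually_le_const (show (0:ℝ) < 1 by norm_num)
  have h4 := Real.tendsto_log_atTop.eventually_ge_atTop 1
  obtain ⟨x₀, hx₀⟩ := Filter.eventually_atTop.1 (h3.and h4)
  refine ⟨x₀, fun x hx => ⟨(hx₀ x hx).2, ?_⟩⟩
  obtain ⟨h5, h6⟩ := hx₀ x hx
  simp only [Function.comp] at h5
  have hL : 0 < Real.log x := by linarith
  rw [← Real.rpow_mul hL.le, mul_div_cancel₀ _ hε.ne', Real.rpow_add hL] at h5
  rw [Real.rpow_neg hL.le, ← one_div, le_div_iff₀ (by positivity)]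
  linarith

lemma final {A b : ℕ → ℕ → ℂ} {K : ℝ} (H : Hyp A b K) (B ε : ℝ) (hε : 0 < ε) : ∃ C : ℝ, 0 < C ∧ ∃ x₀ : ℝ,
    ∀ x y P Q : ℝ, x₀ ≤ x →
    x ^ ε ≤ y → y ≤ x → 2 ≤ P → P ≤ Q → Q ≤ Real.exp (Real.log x ^ (1 - ε : ℝ)) →
    ∑ n ∈ Finset.Ioc ⌊x⌋₊ ⌊x + y⌋₊, ‖(∑ q ∈ Finset.Icc 1 ⌊P⌋₊, A n q) -
        ∏ p ∈ (Finset.Icc 1 ⌊Q⌋₊).filter Nat.Prime, (1 + ∑' k : ℕ, A n (p ^ (k + 1)))‖ ^ 2 ≤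
      C * (y * P⁻¹ * Real.log x + y * Real.log x ^ (-B)) := by
  obtain ⟨C, hC, hc⟩ := core H
  have hK := H.hK
  set c := 12 * Real.exp 3 * K with hcd
  have hc0 : 0 ≤ c := by positivity
  obtain ⟨x₀, hx₀⟩ := ev_bound c B ε hε
  refine ⟨12 * C + 4 * Real.exp (4 * c), by positivity, max x₀ 1, fun x y P Q hx hxy hyx hP hPQ hQ => ?_⟩
  obtain ⟨hL1, hev⟩ := hx₀ x ((le_max_left _ _).trans hx)
  have hx1 : 1 ≤ x := (le_max_right _ _).trans hx
  set L := Real.log x with hL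
  have hL0 : 0 < L := by linarith
  have hy1 : 1 ≤ y := (Real.one_le_rpow hx1 hε.le).trans hxy
  have hy0 : 0 < y := by linarith
  have hly : ε * L ≤ Real.log y := by
    rw [hL, ← Real.log_rpow (by linarith)]
    exact Real.log_le_log (by positivity) hxy
  have hlyL : Real.log y ≤ L := Real.log_le_log hy0 hyx
  have hP0 : 0 < P := by linarith
  have hQ2 : 2 ≤ Q := hP.trans hPQ
  have hlQ : 0 < Real.log Q := Real.log_pos (by linarith)
  have hlQ' : Real.log Q ≤ L ^ (1 - ε) := by
    have := Real.log_le_log (by linarith) hQ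
    rwa [Real.log_exp] at this
  have hlQL : Real.log Q ≤ L := hlQ'.trans (by
    calc L ^ (1 - ε) ≤ L ^ (1 : ℝ) := Real.rpow_le_rpow_of_exponent_le hL1 (by linarith)
      _ = L := Real.rpow_one L)
  have hz1 : 1 ≤ y ^ (1 / 4 : ℝ) := Real.one_le_rpow hy1 (by norm_num)
  have hz4 : (y ^ (1 / 4 : ℝ)) ^ 4 = y := by
    rw [← Real.rpow_natCast, ← Real.rpow_mul hy0.le]; norm_num
  have hlz : Real.log (y ^ (1 / 4 : ℝ)) = Real.log y / 4 := by
    rw [Real.log_rpow hy0]; ring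
  have hM : ((⌊x + y⌋₊ - ⌊x⌋₊ : ℕ) : ℝ) ≤ 2 * y := by
    rw [Nat.cast_sub (Nat.floor_mono (by linarith))]
    have a1 := Nat.floor_le (show 0 ≤ x + y by linarith)
    have a2 := Nat.lt_floor_add_one x
    linarith
  refine (hc P Q (y ^ (1 / 4 : ℝ)) hP hPQ hz1 ⌊x⌋₊ ⌊x + y⌋₊).trans ?_
  rw [hz4, hlz]
  set M := ((⌊x + y⌋₊ - ⌊x⌋₊ : ℕ) : ℝ)
  have hly0 : 0 ≤ Real.log y := Real.log_nonneg hy1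
  have t1 : (M + y) * (P⁻¹ * (C * (1 + Real.log y / 4))) ≤ (3 * y) * (P⁻¹ * (C * (2 * L))) := by
    gcongr <;> linarith
  have hE : (Real.exp (-(Real.log y / 4 / Real.log Q)) * Real.exp (c * (1 + Real.log (2 * Real.log Q)))) ^ 2 ≤
      Real.exp (4 * c) * L ^ (-B) := by
    have q1 : ε / 4 * L ^ ε ≤ Real.log y / 4 / Real.log Q := by
      rw [le_div_iff₀ hlQ]
      calc ε / 4 * L ^ ε * Real.log Q ≤ ε / 4 * L ^ ε * L ^ (1 - ε) := by gcongr
        _ = ε / 4 * (L ^ ε * L ^ (1 - ε)) := by ring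
        _ = ε / 4 * L := by rw [← Real.rpow_add hL0]; norm_num
        _ ≤ _ := by linarith
    have q2 : Real.log (2 * Real.log Q) ≤ 1 + Real.log L := by
      rw [Real.log_mul (by norm_num) hlQ.ne']
      have := Real.log_le_log hlQ hlQL
      have := Real.log_two_lt_d9
      linarith
    have q3 : c * (1 + Real.log (2 * Real.log Q)) ≤ c * (2 + Real.log L) :=
      mul_le_mul_of_nonneg_left (by linarith) hc0
    rw [← Real.exp_add, ← Real.exp_nat_mul]
    calc _ ≤ Real.exp (4 * c + (Real.log L * (2 * c) + -(ε / 2) * L ^ ε)) := by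
          apply Real.exp_le_exp.2
          push_cast
          linarith
      _ = Real.exp (4 * c) * (L ^ (2 * c) * Real.exp (-(ε / 2) * L ^ ε)) := by
          rw [Real.exp_add, Real.exp_add, Real.rpow_def_of_pos hL0 (2 * c)]
      _ ≤ _ := by gcongr
  have t2 : M * (Real.exp (-(Real.log y / 4 / Real.log Q)) * Real.exp (c * (1 + Real.log (2 * Real.log Q)))) ^ 2 ≤
      (2 * y) * (Real.exp (4 * c) * L ^ (-B)) := by
    gcongr
  have r1 : 0 ≤ y * P⁻¹ * L := by positivity
  have r2 : 0 ≤ y * L ^ (-B) := by positivity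
  have r3 : 0 ≤ C * (y * L ^ (-B)) := by positivity
  have r4 : 0 ≤ Real.exp (4 * c) * (y * P⁻¹ * L) := by positivity
  calc _ ≤ 2 * ((3 * y) * (P⁻¹ * (C * (2 * L)))) + 2 * ((2 * y) * (Real.exp (4 * c) * L ^ (-B))) := by
        linarith
    _ ≤ _ := by linarith

/-- Lemma 8 of the paper: mean-square approximation of the
truncated singular series by the partial singular product, for `j = 2, 3`. -/
theorem statement10 :
    ∀ A ε : ℝ, 2 ≤ A → 0 < ε → ∃ C : ℝ, 0 < C ∧ ∃ x₀ : ℝ,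
    ∀ x y P Q : ℝ, x₀ ≤ x →
    x ^ ε ≤ y → y ≤ x → 2 ≤ P → P ≤ Q → Q ≤ Real.exp (Real.log x ^ (1 - ε : ℝ)) →
    (∑ n ∈ Finset.Ioc ⌊x⌋₊ ⌊x + y⌋₊, ‖SS2 n P - PP2 n Q‖ ^ 2 ≤
      C * (y * P⁻¹ * Real.log x + y * Real.log x ^ (-A))) ∧
    (∑ n ∈ Finset.Ioc ⌊x⌋₊ ⌊x + y⌋₊, ‖SS3 n P - PP3 n Q‖ ^ 2 ≤
      C * (y * P⁻¹ * Real.log x + y * Real.log x ^ (-A))) := by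
  intro A ε _ hε
  obtain ⟨C2, hC2, x2, h2⟩ := final Hyp2 A ε hε
  obtain ⟨C3, hC3, x3, h3⟩ := final Hyp3 A ε hε
  refine ⟨C2 + C3, by positivity, max (max x2 x3) 1, fun x y P Q hx hxy hyx hP hPQ hQ => ?_⟩
  have hx2 : x2 ≤ x := ((le_max_left _ _).trans (le_max_left _ _)).trans hx
  have hx3 : x3 ≤ x := ((le_max_right _ _).trans (le_max_left _ _)).trans hx
  have hx1 : 1 ≤ x := (le_max_right _ _).trans hx
  have hL : 0 ≤ Real.log x := Real.log_nonneg hx1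
  have hy : 0 ≤ y := le_trans (by positivity) hxy
  have hP0 : 0 < P := by linarith
  have hT : 0 ≤ y * P⁻¹ * Real.log x + y * Real.log x ^ (-A) := by positivity
  have e2 := mul_nonneg hC2.le hT
  have e3 := mul_nonneg hC3.le hT
  constructor
  · refine (h2 x y P Q hx2 hxy hyx hP hPQ hQ).trans ?_
    rw [add_mul]; linarith
  · refine (h3 x y P Q hx3 hxy hyx hP hPQ hQ).trans ?_
    rw [add_mul]; linarith
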